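/- arXiv:1605.07897 — 13 statements merged into one kernel-verified Lean document; each statement's English description precedes it below -/
import Mathlib

section
/- Let f : ℝ → ℝ be three times continuously differentiable with f''(x) > 0 for all x, and let f* be its Legendre–Fenchel conjugate. Then for every x ∈ ℝ, writing s = f'(x), the conjugate f* is three times differentiable at s and (f*)'''(s)·((f*)''(s))^{−3/2} + f'''(x)·(f''(x))^{−3/2} = 0. In particular |(f*)'''(s)·((f*)''(s))^{−3/2}| = |f'''(x)·(f''(x))^{−3/2}|, i.e. the Legendre invariant of f equals that of f*. -/
/-- The Legendre–Fenchel conjugate of `f : ℝ → ℝ`. -/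
noncomputable def legendreConj (f : ℝ → ℝ) (s : ℝ) : ℝ :=
  ⨆ x : ℝ, (s * x - f x)

open Filter Topology

/-- The supremum defining the conjugate of a differentiable function with monotone derivative
is attained at the point where the slope matches. -/
theorem legendreConj_deriv {f : ℝ → ℝ} (hf : Differentiable ℝ f) (hmono : Monotone (deriv f))
    (x : ℝ) : legendreConj f (deriv f x) = deriv f x * x - f x := by
  have hconv : ConvexOn ℝ Set.univ f := hmono.convexOn_univ_of_deriv hf
  have hle : ∀ y, deriv f x * y - f y ≤ deriv f x * x - f x := by
    intro y
    rcases lt_trichotomy x y with h | h | h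
    · have := hconv.deriv_le_slope (Set.mem_univ x) (Set.mem_univ y) h (hf x)
      rw [slope_def_field, le_div_iff₀ (sub_pos.2 h)] at this
      linarith
    · rw [h]
    · have := hconv.slope_le_deriv (Set.mem_univ y) (Set.mem_univ x) h (hf x)
      rw [slope_def_field, div_le_iff₀ (sub_pos.2 h)] at this
      linarith
  exact le_antisymm (ciSup_le hle) (le_ciSup (f := fun y => deriv f x * y - f y)
    ⟨_, Set.forall_mem_range.2 hle⟩ x)

/-- **Legendre invariant identity.** If `f` is three times continuously differentiable
with `f'' > 0` everywhere, then at `s = f'(x)` the conjugate `f*` is three times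
(continuously) differentiable and
`(f*)'''(s)·((f*)''(s))^{−3/2} + f'''(x)·(f''(x))^{−3/2} = 0`; in particular the
Legendre invariants of `f` and `f*` coincide. -/
theorem legendre_invariant (f : ℝ → ℝ) (hf : ContDiff ℝ 3 f)
    (hf'' : ∀ x, 0 < deriv (deriv f) x) (x : ℝ) :
    ContDiffAt ℝ 3 (legendreConj f) (deriv f x) ∧
    deriv (deriv (deriv (legendreConj f))) (deriv f x) *
        (deriv (deriv (legendreConj f)) (deriv f x)) ^ ((-3 : ℝ) / 2) +
      deriv (deriv (deriv f)) x * (deriv (deriv f) x) ^ ((-3 : ℝ) / 2) = 0 ∧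
    |deriv (deriv (deriv (legendreConj f))) (deriv f x) *
        (deriv (deriv (legendreConj f)) (deriv f x)) ^ ((-3 : ℝ) / 2)| =
      |deriv (deriv (deriv f)) x * (deriv (deriv f) x) ^ ((-3 : ℝ) / 2)| := by
  have hf1 : Differentiable ℝ f := hf.differentiable (by norm_num)
  have hg : ContDiff ℝ 2 (deriv f) :=
    (contDiff_succ_iff_deriv.1 (show ContDiff ℝ (2 + 1) f by norm_num; exact hf)).2.2
  have hg' : ContDiff ℝ 1 (deriv (deriv f)) :=
    (contDiff_succ_iff_deriv.1 (show ContDiff ℝ (1 + 1) (deriv f) by norm_num; exact hg)).2.2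
  have hmono : StrictMono (deriv f) := strictMono_of_deriv_pos hf''
  have hstrict (z : ℝ) : HasStrictDerivAt (deriv f) (deriv (deriv f) z) z :=
    hg.contDiffAt.hasStrictDerivAt (by norm_num)
  set U := Set.range (deriv f)
  have hU : IsOpen U := by
    rw [isOpen_iff_mem_nhds]
    rintro _ ⟨z, rfl⟩
    rw [← (hstrict z).map_nhds_eq (hf'' z).ne']
    exact range_mem_map
  set h := Function.invFun (deriv f)
  have hh (z : ℝ) : h (deriv f z) = z := Function.leftInverse_invFun hmono.injective z
  have hh' : ∀ y ∈ U, HasDerivAt h (deriv (deriv f) (h y))⁻¹ y := by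
    rintro _ ⟨z, rfl⟩
    rw [hh]
    exact ((hstrict z).to_local_left_inverse (hf'' z).ne' (.of_forall hh)).hasDerivAt
  have hF : ∀ y ∈ U, legendreConj f y = y * h y - f (h y) := by
    rintro _ ⟨z, rfl⟩
    rw [hh, legendreConj_deriv hf1 hmono.monotone]
  have hF' : ∀ y ∈ U, HasDerivAt (legendreConj f) (h y) y := by
    intro y hy
    have hfh : deriv f (h y) = y := by
      obtain ⟨z, rfl⟩ := hy
      rw [hh]
    have key := ((hasDerivAt_id y).mul (hh' y hy)).sub
      ((hf1 (h y)).hasDerivAt.comp y (hh' y hy))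
    refine (key.congr_of_eventuallyEq ?_).congr_deriv ?_
    · filter_upwards [hU.mem_nhds hy] with w hw using hF w hw
    · simp [hfh]
  have hdF : Set.EqOn (deriv (legendreConj f)) h U := fun y hy => (hF' y hy).deriv
  have hdh : Set.EqOn (deriv h) (fun y => (deriv (deriv f) (h y))⁻¹) U :=
    fun y hy => (hh' y hy).deriv
  have hddF : Set.EqOn (deriv (deriv (legendreConj f)))
      (fun y => (deriv (deriv f) (h y))⁻¹) U :=
    (hdF.deriv hU).trans hdh
  have hdh_diff : DifferentiableOn ℝ h U :=
    fun y hy => (hh' y hy).differentiableAt.differentiableWithinAt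
  have hh1 : ContDiffOn ℝ 1 h U := by
    refine (contDiffOn_succ_iff_deriv_of_isOpen (n := 0) hU).2 ⟨hdh_diff, by simp, ?_⟩
    rw [contDiffOn_zero]
    exact ((hg'.continuous.comp_continuousOn hdh_diff.continuousOn).inv₀
      fun y _ => (hf'' _).ne').congr hdh
  have hh2 : ContDiffOn ℝ 2 h U := by
    have := (contDiffOn_succ_iff_deriv_of_isOpen (n := 1) hU).2 ⟨hdh_diff, by simp,
      ((hg'.comp_contDiffOn hh1).inv fun y _ => (hf'' _).ne').congr hdh⟩
    norm_num at this
    exact this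
  have hF3 : ContDiffOn ℝ 3 (legendreConj f) U := by
    have := (contDiffOn_succ_iff_deriv_of_isOpen (n := 2) hU).2
      ⟨fun y hy => (hF' y hy).differentiableAt.differentiableWithinAt, by simp, hh2.congr hdF⟩
    norm_num at this
    exact this
  have hxU : deriv f x ∈ U := ⟨x, rfl⟩
  set a := deriv (deriv f) x with ha_def
  set b := deriv (deriv (deriv f)) x
  have ha : 0 < a := hf'' x
  have h2 : deriv (deriv (legendreConj f)) (deriv f x) = a⁻¹ := by
    simp only [hddF hxU, hh, ha_def]
  have h3 : deriv (deriv (deriv (legendreConj f))) (deriv f x) = -(b * a⁻¹) / a ^ 2 := by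
    rw [hddF.deriv hU hxU]
    have hb : HasDerivAt (deriv (deriv f)) b (h (deriv f x)) := by
      rw [hh]
      exact (hg'.differentiable (by norm_num) x).hasDerivAt
    have hcomp := (hb.comp (deriv f x) (hh' _ hxU)).inv (hf'' _).ne'
    simp only [Function.comp_apply, hh] at hcomp
    exact hcomp.deriv
  have hzero : deriv (deriv (deriv (legendreConj f))) (deriv f x) *
        (deriv (deriv (legendreConj f)) (deriv f x)) ^ ((-3 : ℝ) / 2) +
      b * a ^ ((-3 : ℝ) / 2) = 0 := by
    have hpow : (a⁻¹) ^ ((-3 : ℝ) / 2) = a ^ 3 * a ^ ((-3 : ℝ) / 2) := by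
      rw [Real.inv_rpow ha.le, ← Real.rpow_neg ha.le, ← Real.rpow_natCast, ← Real.rpow_add ha]
      norm_num
    rw [h2, h3, hpow]
    field_simp
    ring
  refine ⟨hF3.contDiffAt (hU.mem_nhds hxU), hzero, ?_⟩
  rw [eq_neg_of_add_eq_zero_left hzero, abs_neg]
end

section
/- Let d : ℝ^m → ℝ be concave and continuous, assume the set L* = Argmax{ d(λ) : λ ∈ ℝ^m } is nonempty and bounded, and let (k_s) be a strictly increasing sequence of positive reals with k_s → ∞. For each s let λ_s be the unique maximizer of u ↦ d(u) − (2k_s)^{−1}‖u‖² over ℝ^m. Then: (1) ‖λ_{s+1}‖ ≥ ‖λ_s‖ and d(λ_{s+1}) ≥ d(λ_s) for all s, with both inequalities strict whenever λ_{s+1} ≠ λ_s; (2) λ_s converges to λ* = argmin{ ‖λ‖ : λ ∈ L* }, the minimum-norm maximizer of d. -/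
open Filter

section Regularization

variable {E : Type*}

/-- Maximizers of `d - c * ‖·‖ ^ 2` have norm and `d`-value nondecreasing as `c` decreases. -/
theorem norm_le_and_le_of_isMax_regularized [NormedAddCommGroup E] {d : E → ℝ} {a b : ℝ} {x y : E}
    (hb : 0 < b) (hab : b < a)
    (hx : d y - a * ‖y‖ ^ 2 ≤ d x - a * ‖x‖ ^ 2)
    (hy : d x - b * ‖x‖ ^ 2 ≤ d y - b * ‖y‖ ^ 2) :
    ‖x‖ ≤ ‖y‖ ∧ d x ≤ d y ∧ (‖x‖ < ‖y‖ → d x < d y) := by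
  have hsq : ‖x‖ ^ 2 ≤ ‖y‖ ^ 2 := by
    have : 0 ≤ (a - b) * (‖y‖ ^ 2 - ‖x‖ ^ 2) := by linarith
    linarith [nonneg_of_mul_nonneg_right this (sub_pos.2 hab)]
  refine ⟨le_of_sq_le_sq hsq (norm_nonneg y), ?_, fun h => ?_⟩
  · linarith [mul_le_mul_of_nonneg_left hsq hb.le]
  · linarith [mul_lt_mul_of_pos_left (pow_lt_pow_left₀ h (norm_nonneg x) two_ne_zero) hb]

/-- A regularized maximizer is no larger in norm than any maximizer. -/
theorem norm_le_of_isMax_regularized [NormedAddCommGroup E] {d : E → ℝ} {c : ℝ} {x μ : E}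
    (hc : 0 < c) (hμ : d x ≤ d μ)
    (hx : d μ - c * ‖μ‖ ^ 2 ≤ d x - c * ‖x‖ ^ 2) : ‖x‖ ≤ ‖μ‖ :=
  le_of_sq_le_sq (le_of_mul_le_mul_left (by linarith) hc) (norm_nonneg μ)

/-- In a strictly convex space, a concave function has at most one minimum-norm maximizer. -/
theorem ConcaveOn.eq_of_isMax_of_norm_minimal [NormedAddCommGroup E] [NormedSpace ℝ E]
    [StrictConvexSpace ℝ E] {d : E → ℝ} (hd : ConcaveOn ℝ Set.univ d) {x y : E}
    (hx : ∀ ν, d ν ≤ d x) (hy : ∀ ν, d ν ≤ d y)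
    (hmin : ∀ μ, (∀ ν, d ν ≤ d μ) → ‖x‖ ≤ ‖μ‖) (hyx : ‖y‖ ≤ ‖x‖) : y = x := by
  by_contra hne
  have hxy : ‖x‖ = ‖y‖ := le_antisymm (hmin y hy) hyx
  have hlt := (norm_midpoint_lt_iff hxy).2 (Ne.symm hne)
  refine hlt.not_ge (hmin _ fun ν => ?_)
  have hmid := hd.2 (Set.mem_univ x) (Set.mem_univ y) (by norm_num : (0 : ℝ) ≤ 1 / 2)
    (by norm_num : (0 : ℝ) ≤ 1 / 2) (by norm_num)
  rw [smul_eq_mul, smul_eq_mul, ← smul_add (1 / 2 : ℝ) x y] at hmid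
  linarith [hx ν, hy ν]

/-- Regularized maximizers converge to the minimum-norm maximizer as the regularization
parameter tends to zero. -/
theorem ConcaveOn.tendsto_isMax_regularized [NormedAddCommGroup E] [NormedSpace ℝ E]
    [StrictConvexSpace ℝ E] [ProperSpace E] {ι : Type*} {l : Filter ι} {d : E → ℝ}
    (hd : ConcaveOn ℝ Set.univ d) (hcont : Continuous d) {c : ι → ℝ} (hc0 : ∀ i, 0 < c i)
    (hc : Tendsto c l (nhds 0)) {lam : ι → E} {x : E} (hx : ∀ ν, d ν ≤ d x)
    (hmin : ∀ μ, (∀ ν, d ν ≤ d μ) → ‖x‖ ≤ ‖μ‖)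
    (hlam : ∀ i, d x - c i * ‖x‖ ^ 2 ≤ d (lam i) - c i * ‖lam i‖ ^ 2) :
    Tendsto lam l (nhds x) := by
  have hval : Tendsto (d ∘ lam) l (nhds (d x)) := by
    have hlow : Tendsto (fun i => d x - c i * ‖x‖ ^ 2) l (nhds (d x)) := by
      simpa using (hc.mul_const (‖x‖ ^ 2)).const_sub (d x)
    refine tendsto_of_tendsto_of_tendsto_of_le_of_le hlow tendsto_const_nhds (fun i => ?_)
      fun i => hx (lam i)
    have := mul_nonneg (hc0 i).le (sq_nonneg ‖lam i‖)
    simp only [Function.comp_apply]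
    linarith [hlam i]
  refine (isCompact_closedBall (0 : E) ‖x‖).tendsto_nhds_of_unique_mapClusterPt
    (Eventually.of_forall fun i => ?_) fun y hy hcl => ?_
  · exact mem_closedBall_zero_iff.2 (norm_le_of_isMax_regularized (hc0 i) (hx _) (hlam i))
  · have hdy : d y = d x := by
      have hcl' : MapClusterPt (d y) l (d ∘ lam) := hcl.continuousAt_comp hcont.continuousAt
      exact eq_of_nhds_neBot (hcl'.neBot.mono (inf_le_inf_left _ hval))
    exact hd.eq_of_isMax_of_norm_minimal hx (fun ν => (hx ν).trans hdy.ge) hmin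
      (mem_closedBall_zero_iff.1 hy)

end Regularization

/-- **Tikhonov regularization of the dual problem.** Let `d` be concave and continuous
on `ℝ^m` with nonempty bounded set of maximizers `L*`, and let `(k_s)` be a strictly
increasing positive regularization sequence tending to `∞`.  If `λ_s` is the unique
maximizer of `u ↦ d(u) − (2k_s)⁻¹‖u‖²`, then the norms `‖λ_s‖` and the values `d(λ_s)`
are nondecreasing (strictly whenever `λ_{s+1} ≠ λ_s`), and `λ_s` converges to the
minimum-norm maximizer of `d`. -/
theorem tikhonov_dual_regularization {m : ℕ}
    (d : EuclideanSpace ℝ (Fin m) → ℝ)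
    (hconc : ConcaveOn ℝ Set.univ d) (hcont : Continuous d)
    (Lstar : Set (EuclideanSpace ℝ (Fin m)))
    (hLstar : Lstar = {μ | ∀ ν, d ν ≤ d μ})
    (hne : Lstar.Nonempty) (hbd : Bornology.IsBounded Lstar)
    (k : ℕ → ℝ) (hk0 : ∀ s, 0 < k s) (hkmono : StrictMono k)
    (hkinf : Tendsto k atTop atTop)
    (lam : ℕ → EuclideanSpace ℝ (Fin m))
    (hmax : ∀ s, ∀ u, d u - (2 * k s)⁻¹ * ‖u‖ ^ 2 ≤ d (lam s) - (2 * k s)⁻¹ * ‖lam s‖ ^ 2)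
    (huniq : ∀ s u,
      (∀ v, d v - (2 * k s)⁻¹ * ‖v‖ ^ 2 ≤ d u - (2 * k s)⁻¹ * ‖u‖ ^ 2) → u = lam s) :
    (∀ s, ‖lam s‖ ≤ ‖lam (s + 1)‖ ∧ d (lam s) ≤ d (lam (s + 1)) ∧
      (lam (s + 1) ≠ lam s → ‖lam s‖ < ‖lam (s + 1)‖ ∧ d (lam s) < d (lam (s + 1)))) ∧
    ∃ lamstar ∈ Lstar, (∀ μ ∈ Lstar, ‖lamstar‖ ≤ ‖μ‖) ∧
      Tendsto lam atTop (nhds lamstar) := by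
  have hc0 : ∀ s, 0 < (2 * k s)⁻¹ := fun s => inv_pos.2 (mul_pos two_pos (hk0 s))
  subst hLstar
  refine ⟨fun s => ?_, ?_⟩
  · have hlt : (2 * k (s + 1))⁻¹ < (2 * k s)⁻¹ :=
      inv_strictAnti₀ (mul_pos two_pos (hk0 s))
        (mul_lt_mul_of_pos_left (hkmono s.lt_succ_self) two_pos)
    obtain ⟨hnorm, hval, hstrict⟩ := norm_le_and_le_of_isMax_regularized (hc0 (s + 1)) hlt
      (hmax s (lam (s + 1))) (hmax (s + 1) (lam s))
    refine ⟨hnorm, hval, fun hne' => ?_⟩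
    have hnorm_lt : ‖lam s‖ < ‖lam (s + 1)‖ := by
      refine hnorm.lt_of_ne fun heq => hne' (huniq s _ fun v => (hmax s v).trans ?_)
      rw [heq]
      linarith
    exact ⟨hnorm_lt, hstrict hnorm_lt⟩
  · have hclosed : IsClosed {μ | ∀ ν, d ν ≤ d μ} := by
      simp only [Set.ofPred_forall]
      exact isClosed_iInter fun ν => isClosed_le continuous_const hcont
    obtain ⟨x, hx, hmin⟩ := (Metric.isCompact_of_isClosed_isBounded hclosed hbd).exists_isMinOn hne
      continuous_norm.continuousOn
    have hc : Tendsto (fun s => (2 * k s)⁻¹) atTop (nhds 0) :=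
      tendsto_inv_atTop_zero.comp (hkinf.const_mul_atTop two_pos)
    exact ⟨x, hx, fun μ hμ => hmin hμ,
      hconc.tendsto_isMax_regularized hcont hc0 hc hx (fun μ hμ => hmin hμ) fun s => hmax s x⟩
end

section
/- Let f : ℝ^n → ℝ be convex and differentiable, c_1,…,c_m : ℝ^n → ℝ concave and differentiable, and let d(λ) = inf_{x ∈ ℝ^n} L(x,λ) with L(x,λ) = f(x) − Σ_{i=1}^m λ_i c_i(x). Fix k > 0 and suppose x(k) ∈ ℝ^n satisfies c_i(x(k)) > 0 for all i and ∇f(x(k)) − Σ_{i=1}^m (k c_i(x(k)))^{−1} ∇c_i(x(k)) = 0 (the stationarity condition for the log-barrier penalty P(x,k) = f(x) − k^{−1} Σ ln(k c_i(x))). Define λ_i(k) = (k c_i(x(k)))^{−1}. Then d(λ(k)) = L(x(k), λ(k)) and the primal–dual gap satisfies f(x(k)) − d(λ(k)) = Σ_{i=1}^m λ_i(k) c_i(x(k)) = m/k. Consequently, if x* minimizes f over Ω = { x : c_i(x) ≥ 0, i = 1,…,m } and λ* maximizes d over ℝ^m_+ with f(x*) = d(λ*) (strong duality), then 0 ≤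 f(x(k)) − f(x*) ≤ m/k and 0 ≤ d(λ*) − d(λ(k)) ≤ m/k. -/
open Filter

/-- A stationary point of a convex function is a global minimizer. -/
theorem ConvexOn.le_of_hasFDerivAt_zero {E : Type*} [NormedAddCommGroup E] [NormedSpace ℝ E]
    {g : E → ℝ} {a : E} (hg : ConvexOn ℝ Set.univ g)
    (h : HasFDerivAt g (0 : E →L[ℝ] ℝ) a) (y : E) : g a ≤ g y := by
  have hconv : ConvexOn ℝ Set.univ (g ∘ AffineMap.lineMap (k := ℝ) a y) :=
    hg.comp_affineMap (AffineMap.lineMap a y)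
  have hderiv : HasDerivAt (g ∘ AffineMap.lineMap (k := ℝ) a y) 0 (0 : ℝ) := by
    have h' : HasFDerivAt g (0 : E →L[ℝ] ℝ) (AffineMap.lineMap (k := ℝ) a y (0 : ℝ)) := by
      simpa using h
    simpa using h'.comp_hasDerivAt (0 : ℝ) AffineMap.hasDerivAt_lineMap
  have hslope := hconv.le_slope_of_hasDerivAt (Set.mem_univ 0) (Set.mem_univ 1) one_pos hderiv
  simpa [slope_def_field] using hslope

/-- A finite sum of concave functions on a convex set is concave. -/
theorem Convex.concaveOn_finset_sum {E ι : Type*} [AddCommGroup E] [Module ℝ E] {S : Set E}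
    (hS : Convex ℝ S) (s : Finset ι) {g : ι → E → ℝ} (hg : ∀ i ∈ s, ConcaveOn ℝ S (g i)) :
    ConcaveOn ℝ S fun x => ∑ i ∈ s, g i x := by
  classical
  induction s using Finset.induction_on with
  | empty => simpa using concaveOn_const (0 : ℝ) hS
  | insert i s hi ih =>
    simp only [Finset.sum_insert hi]
    exact (hg i (Finset.mem_insert_self i s)).add
      (ih fun j hj => hg j (Finset.mem_insert_of_mem hj))

/-- **Log-barrier SUMT: duality gap bound.** If `x(k)` is a stationary point of the
log-barrier penalty for the convex program `min { f(x) : cᵢ(x) ≥ 0 }` with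
`cᵢ(x(k)) > 0`, and `λᵢ(k) = (k·cᵢ(x(k)))⁻¹`, then the dual value at `λ(k)` equals the
Lagrangian value at `(x(k), λ(k))`, the primal–dual gap equals `m/k`, and under strong
duality both the primal and the dual errors are at most `m/k`. -/
theorem log_barrier_duality_gap {n m : ℕ}
    (f : EuclideanSpace ℝ (Fin n) → ℝ) (c : Fin m → EuclideanSpace ℝ (Fin n) → ℝ)
    (hfconv : ConvexOn ℝ Set.univ f) (hfd : Differentiable ℝ f)
    (hcconc : ∀ i, ConcaveOn ℝ Set.univ (c i)) (hcd : ∀ i, Differentiable ℝ (c i))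
    (d : (Fin m → ℝ) → ℝ)
    (hd : ∀ lam, d lam = ⨅ x : EuclideanSpace ℝ (Fin n), (f x - ∑ i, lam i * c i x))
    (k : ℝ) (hk : 0 < k)
    (xk : EuclideanSpace ℝ (Fin n)) (hxk : ∀ i, 0 < c i xk)
    (hstat : gradient f xk - ∑ i, (k * c i xk)⁻¹ • gradient (c i) xk = 0)
    (lamk : Fin m → ℝ) (hlamk : ∀ i, lamk i = (k * c i xk)⁻¹) :
    d lamk = f xk - ∑ i, lamk i * c i xk ∧
    f xk - d lamk = ∑ i, lamk i * c i xk ∧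
    (∑ i, lamk i * c i xk) = (m : ℝ) / k ∧
    ∀ (xstar : EuclideanSpace ℝ (Fin n)) (lamstar : Fin m → ℝ),
      (∀ i, 0 ≤ c i xstar) → (∀ x, (∀ i, 0 ≤ c i x) → f xstar ≤ f x) →
      (∀ i, 0 ≤ lamstar i) → (∀ lam, (∀ i, 0 ≤ lam i) → d lam ≤ d lamstar) →
      f xstar = d lamstar →
        0 ≤ f xk - f xstar ∧ f xk - f xstar ≤ (m : ℝ) / k ∧
        0 ≤ d lamstar - d lamk ∧ d lamstar - d lamk ≤ (m : ℝ) / k := by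
  have hpos : ∀ i, 0 ≤ lamk i := fun i => by
    rw [hlamk]
    exact inv_nonneg.2 (mul_pos hk (hxk i)).le
  have hconv : ConvexOn ℝ Set.univ fun x => f x - ∑ i, lamk i * c i x :=
    hfconv.sub (convex_univ.concaveOn_finset_sum Finset.univ
      fun i _ => (hcconc i).smul (hpos i))
  have hderiv : HasFDerivAt (fun x => f x - ∑ i, lamk i * c i x)
      (0 : EuclideanSpace ℝ (Fin n) →L[ℝ] ℝ) xk := by
    have hsum := HasFDerivAt.fun_sum (u := Finset.univ) fun i _ =>
      ((hcd i xk).hasGradientAt.hasFDerivAt.const_mul (lamk i))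
    have hL := (hfd xk).hasGradientAt.hasFDerivAt.fun_sub hsum
    refine hL.congr_fderiv ?_
    have hdual := congrArg (InnerProductSpace.toDual ℝ (EuclideanSpace ℝ (Fin n))) hstat
    simpa [map_sub, map_sum, hlamk] using hdual
  have hdual : d lamk = f xk - ∑ i, lamk i * c i xk := by
    have hmin := hconv.le_of_hasFDerivAt_zero hderiv
    rw [hd]
    exact le_antisymm (ciInf_le ⟨_, Set.forall_mem_range.2 hmin⟩ xk) (le_ciInf hmin)
  have hsum : ∑ i, lamk i * c i xk = (m : ℝ) / k := by
    have hterm : ∀ i, lamk i * c i xk = k⁻¹ := fun i => by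
      have := (hxk i).ne'
      rw [hlamk]
      field_simp
    simp [hterm, div_eq_mul_inv]
  refine ⟨hdual, by rw [hdual]; ring, hsum, ?_⟩
  intro xstar lamstar _ hprimal _ hdualmax hstrong
  have hle := hprimal xk fun i => (hxk i).le
  have hle' := hdualmax lamk hpos
  refine ⟨?_, ?_, ?_, ?_⟩ <;> linarith
end

section
/- Let f : ℝ^n → ℝ be convex and differentiable, c_1,…,c_m : ℝ^n → ℝ concave and differentiable, and let d(λ) = inf_{x ∈ ℝ^n} L(x,λ) with L(x,λ) = f(x) − Σ_{i=1}^m λ_i c_i(x). Fix k > 0 and suppose x(k) ∈ ℝ^n satisfies c_i(x(k)) > 0 for all i and ∇f(x(k)) − Σ_{i=1}^m (k c_i(x(k)))^{−2} ∇c_i(x(k)) = 0 (the stationarity condition for the hyperbolic-barrier penalty P(x,k) = f(x) + k^{−1} Σ (k c_i(x))^{−1}). Define λ_i(k) = (k c_i(x(k)))^{−2} and suppose L ≥ λ_i(k) for all i. Then d(λ(k)) = L(x(k), λ(k)) and the primal–dual gap satisfies f(x(k)) − d(λ(k)) = Σ_{i=1}^m λ_i(k) c_i(x(k)) ≤ m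 √L / k. Consequently, if x* minimizes f over Ω = { x : c_i(x) ≥ 0, i = 1,…,m } and λ* maximizes d over ℝ^m_+ with f(x*) = d(λ*), then 0 ≤ f(x(k)) − f(x*) ≤ m√L/k and 0 ≤ d(λ*) − d(λ(k)) ≤ m√L/k. -/
open Filter

/-- A convex function lies above its tangent hyperplanes. -/
theorem ConvexOn.fderiv_apply_sub_le {E : Type*} [NormedAddCommGroup E] [NormedSpace ℝ E]
    {g : E → ℝ} {x : E} (hg : ConvexOn ℝ Set.univ g) (hd : DifferentiableAt ℝ g x) (y : E) :
    fderiv ℝ g x (y - x) ≤ g y - g x := by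
  have hline : ConvexOn ℝ Set.univ (g ∘ AffineMap.lineMap (k := ℝ) x y) := by
    simpa using hg.comp_affineMap (AffineMap.lineMap (k := ℝ) x y)
  have hderiv : HasDerivAt (g ∘ AffineMap.lineMap (k := ℝ) x y) (fderiv ℝ g x (y - x)) 0 := by
    have hx : HasFDerivAt g (fderiv ℝ g x) (AffineMap.lineMap (k := ℝ) x y 0) := by
      simpa using hd.hasFDerivAt
    exact hx.comp_hasDerivAt 0 AffineMap.hasDerivAt_lineMap
  simpa [slope_def_field] using
    hline.le_slope_of_hasDerivAt (Set.mem_univ 0) (Set.mem_univ 1) zero_lt_one hderiv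

/-- A stationary point of the Lagrangian of a convex program, taken at nonnegative multipliers,
is a global minimizer of it. -/
theorem lagrangian_le_of_gradient_eq_zero {E ι : Type*} [NormedAddCommGroup E]
    [InnerProductSpace ℝ E] [CompleteSpace E] [Fintype ι] {f : E → ℝ} {c : ι → E → ℝ} {x : E}
    (hf : ConvexOn ℝ Set.univ f) (hfd : DifferentiableAt ℝ f x)
    (hc : ∀ i, ConcaveOn ℝ Set.univ (c i)) (hcd : ∀ i, DifferentiableAt ℝ (c i) x)
    {lam : ι → ℝ} (hlam : ∀ i, 0 ≤ lam i)
    (hstat : gradient f x - ∑ i, lam i • gradient (c i) x = 0) (y : E) :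
    f x - ∑ i, lam i * c i x ≤ f y - ∑ i, lam i * c i y := by
  have hfy := hf.fderiv_apply_sub_le hfd y
  have hcy : ∑ i, lam i * (c i y - c i x) ≤ ∑ i, lam i * fderiv ℝ (c i) x (y - x) := by
    refine Finset.sum_le_sum fun i _ => mul_le_mul_of_nonneg_left ?_ (hlam i)
    have h := (hc i).neg.fderiv_apply_sub_le (hcd i).neg y
    simp only [fderiv_neg, neg_apply, Pi.neg_apply] at h
    linarith
  have hinner := congrArg (fun v => inner ℝ v (y - x)) hstat
  simp only [inner_sub_left, sum_inner, real_inner_smul_left, inner_gradient_left,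
    inner_zero_left] at hinner
  simp only [mul_sub, Finset.sum_sub_distrib] at hcy
  linarith

/-- **Hyperbolic-barrier SUMT: duality gap bound.** If `x(k)` is a stationary point of
the hyperbolic-barrier penalty for the convex program `min { f(x) : cᵢ(x) ≥ 0 }` with
`cᵢ(x(k)) > 0`, and `λᵢ(k) = (k·cᵢ(x(k)))⁻²` with `λᵢ(k) ≤ L`, then the dual value at
`λ(k)` equals the Lagrangian value at `(x(k), λ(k))`, the primal–dual gap is at most
`m√L/k`, and under strong duality both the primal and the dual errors are at most
`m√L/k`. -/
theorem hyperbolic_barrier_duality_gap {n m : ℕ}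
    (f : EuclideanSpace ℝ (Fin n) → ℝ) (c : Fin m → EuclideanSpace ℝ (Fin n) → ℝ)
    (hfconv : ConvexOn ℝ Set.univ f) (hfd : Differentiable ℝ f)
    (hcconc : ∀ i, ConcaveOn ℝ Set.univ (c i)) (hcd : ∀ i, Differentiable ℝ (c i))
    (d : (Fin m → ℝ) → ℝ)
    (hd : ∀ lam, d lam = ⨅ x : EuclideanSpace ℝ (Fin n), (f x - ∑ i, lam i * c i x))
    (k : ℝ) (hk : 0 < k)
    (xk : EuclideanSpace ℝ (Fin n)) (hxk : ∀ i, 0 < c i xk)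
    (hstat : gradient f xk - ∑ i, ((k * c i xk) ^ 2)⁻¹ • gradient (c i) xk = 0)
    (lamk : Fin m → ℝ) (hlamk : ∀ i, lamk i = ((k * c i xk) ^ 2)⁻¹)
    (L : ℝ) (hL : ∀ i, lamk i ≤ L) :
    d lamk = f xk - ∑ i, lamk i * c i xk ∧
    f xk - d lamk = ∑ i, lamk i * c i xk ∧
    (∑ i, lamk i * c i xk) ≤ (m : ℝ) * Real.sqrt L / k ∧
    ∀ (xstar : EuclideanSpace ℝ (Fin n)) (lamstar : Fin m → ℝ),
      (∀ i, 0 ≤ c i xstar) → (∀ x, (∀ i, 0 ≤ c i x) → f xstar ≤ f x) →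
      (∀ i, 0 ≤ lamstar i) → (∀ lam, (∀ i, 0 ≤ lam i) → d lam ≤ d lamstar) →
      f xstar = d lamstar →
        0 ≤ f xk - f xstar ∧ f xk - f xstar ≤ (m : ℝ) * Real.sqrt L / k ∧
        0 ≤ d lamstar - d lamk ∧ d lamstar - d lamk ≤ (m : ℝ) * Real.sqrt L / k := by
  have hlam0 : ∀ i, 0 ≤ lamk i := fun i => by rw [hlamk i]; positivity
  have hmin := lagrangian_le_of_gradient_eq_zero hfconv (hfd xk) hcconc (fun i => hcd i xk) hlam0
    (by simpa only [hlamk] using hstat)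
  have hdual : d lamk = f xk - ∑ i, lamk i * c i xk := by
    rw [hd]
    exact le_antisymm (ciInf_le ⟨_, Set.forall_mem_range.2 hmin⟩ xk) (le_ciInf hmin)
  have hbound : (∑ i, lamk i * c i xk) ≤ (m : ℝ) * Real.sqrt L / k := by
    have hterm : ∀ i, lamk i * c i xk ≤ Real.sqrt L / k := fun i => by
      have hci := hxk i
      have hsqrt : (k * c i xk)⁻¹ ≤ Real.sqrt L := by
        apply Real.le_sqrt_of_sq_le
        rw [inv_pow, ← hlamk i]
        exact hL i
      calc lamk i * c i xk = (k * c i xk)⁻¹ / k := by rw [hlamk i]; field_simp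
        _ ≤ Real.sqrt L / k := by gcongr
    calc (∑ i, lamk i * c i xk) ≤ ∑ _i : Fin m, Real.sqrt L / k :=
          Finset.sum_le_sum fun i _ => hterm i
      _ = (m : ℝ) * Real.sqrt L / k := by simp [mul_div_assoc]
  refine ⟨hdual, by linarith, hbound, fun xstar lamstar _ hprimal _ hmax hstrong => ?_⟩
  have hp := hprimal xk fun i => (hxk i).le
  have hq := hmax lamk hlam0
  refine ⟨?_, ?_, ?_, ?_⟩ <;> linarith
end

section
/- Let d : ℝ^m → ℝ be concave, let λ* be a maximizer of d over ℝ^m_+, let k > 0, and let λ, λ⁺ ∈ ℝ^m with all components strictly positive and c ∈ ℝ^m satisfy the MBF multiplier update λ⁺_i = λ_i (k c_i + 1)^{−1} for i = 1,…,m (so k c_i + 1 > 0), and suppose −c is a supergradient of d at λ⁺, i.e. d(u) − d(λ⁺) ≤ ⟨−c, u − λ⁺⟩ for all u ∈ ℝ^m_+. Then, with the Kullback–Leibler divergence D(λ*, v) = Σ_{i=1}^m ( −λ*_i ln(v_i/λ*_i) + v_i − λ*_i ) (using the convention 0·ln 0 = 0 when λ*_i = 0), one has D(λ*, λ) − D(λ*,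 λ⁺) ≥ k ( d(λ*) − d(λ⁺) ) ≥ 0. -/
/-- One coordinate of the Kullback–Leibler decrease: replacing `a * (t + 1)` by `a` decreases
the divergence to `s` by at least `t * (a - s)`. -/
theorem mul_sub_le_kl_sub_kl {s a t : ℝ} (hs : 0 ≤ s) (ha : 0 < a) (ht : 0 < t + 1) :
    t * (a - s) ≤ (-s * Real.log (a * (t + 1) / s) + a * (t + 1) - s) -
      (-s * Real.log (a / s) + a - s) := by
  rcases hs.eq_or_lt with rfl | hs
  · simp only [neg_zero, zero_mul]
    linarith
  · have hlog : Real.log (t + 1) ≤ t := by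
      linarith [Real.log_le_sub_one_of_pos ht]
    rw [mul_div_right_comm, Real.log_mul (div_pos ha hs).ne' ht.ne']
    linarith [mul_le_mul_of_nonneg_left hlog hs.le]

/-- **Kullback–Leibler contraction of the MBF multiplier update.** For a concave dual
function `d` maximized over `ℝ^m₊` at `λ*`, a strictly positive pair `λ, λ⁺` related by
the MBF multiplier update `λ⁺ᵢ = λᵢ (k cᵢ + 1)⁻¹` with `−c` a supergradient of `d` at
`λ⁺`, the Kullback–Leibler divergence to `λ*` decreases by at least
`k (d(λ*) − d(λ⁺)) ≥ 0`. -/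
theorem mbf_kl_contraction {m : ℕ}
    (d : (Fin m → ℝ) → ℝ) (hconc : ConcaveOn ℝ Set.univ d)
    (lamstar : Fin m → ℝ) (hstar_nn : ∀ i, 0 ≤ lamstar i)
    (hstar_max : ∀ u, (∀ i, 0 ≤ u i) → d u ≤ d lamstar)
    (k : ℝ) (hk : 0 < k)
    (lam lamp : Fin m → ℝ) (c : Fin m → ℝ)
    (hlam : ∀ i, 0 < lam i) (hlamp : ∀ i, 0 < lamp i)
    (hpos : ∀ i, 0 < k * c i + 1)
    (hupd : ∀ i, lamp i = lam i * (k * c i + 1)⁻¹)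
    (hsupg : ∀ u, (∀ i, 0 ≤ u i) → d u - d lamp ≤ ∑ i, (-(c i)) * (u i - lamp i)) :
    (∑ i, (-(lamstar i) * Real.log (lam i / lamstar i) + lam i - lamstar i)) -
      (∑ i, (-(lamstar i) * Real.log (lamp i / lamstar i) + lamp i - lamstar i)) ≥
        k * (d lamstar - d lamp) ∧
    0 ≤ k * (d lamstar - d lamp) := by
  refine ⟨?_, mul_nonneg hk.le (sub_nonneg.2 (hstar_max lamp fun i => (hlamp i).le))⟩
  rw [ge_iff_le, ← Finset.sum_sub_distrib]
  refine (mul_le_mul_of_nonneg_left (hsupg lamstar hstar_nn) hk.le).trans ?_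
  rw [Finset.mul_sum]
  refine Finset.sum_le_sum fun i _ => ?_
  have hlam_eq : lam i = lamp i * (k * c i + 1) := by
    rw [hupd i, inv_mul_cancel_right₀ (hpos i).ne']
  rw [hlam_eq]
  linarith [mul_sub_le_kl_sub_kl (hstar_nn i) (hlamp i) (hpos i)]
end

section
/- Let d : ℝ^m → ℝ be concave and continuous with nonempty bounded set of maximizers L* over ℝ^m_+, and let k > 0. Suppose sequences (λ_s) in ℝ^m with all components strictly positive and (c_s) in ℝ^m satisfy, for every s ≥ 0: λ_{i,s+1} = λ_{i,s} ( k c_{i,s} + 1 )^{−1} for i = 1,…,m, and −c_s is a supergradient of d at λ_{s+1}, i.e. d(u) − d(λ_{s+1}) ≤ ⟨−c_s, u − λ_{s+1}⟩ for all u ∈ ℝ^m_+. Then the sequence ( d(λ_s) ) is nondecreasing, lim_{s→∞} d(λ_s) = d(λ*) = max{ d(λ) : λ ∈ ℝ^m_+ }, and the asymptotic complementarity condition lim_{s→∞} ⟨λ_{s+1}, c_s⟩ = 0 holds. -/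
open Filter

/-- A linear upper bound with slope `1 / 2` for a nonnegative multiple of the logarithm. -/
lemma mul_log_le_half_add {u v : ℝ} (hu : 0 ≤ u) (hv : 0 < v) :
    u * Real.log v ≤ v / 2 + u * Real.log (2 * (u + 1)) := by
  have ha : 0 < 2 * (u + 1) := by linarith
  have h := Real.log_le_sub_one_of_pos (div_pos hv ha)
  rw [Real.log_div hv.ne' ha.ne'] at h
  have hq : u * (v / (2 * (u + 1))) ≤ v / 2 := by
    rw [mul_div_assoc', div_le_div_iff₀ ha two_pos]
    nlinarith
  nlinarith [mul_le_mul_of_nonneg_left h hu]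

/-- The part of the Kullback–Leibler divergence from `u` to `v` that depends on `v`. -/
noncomputable def klPotential {m : ℕ} (u v : Fin m → ℝ) : ℝ :=
  ∑ i, (v i - u i * Real.log (v i))

lemma half_sum_sub_le_klPotential {m : ℕ} {u v : Fin m → ℝ} (hu : ∀ i, 0 ≤ u i)
    (hv : ∀ i, 0 < v i) :
    (∑ i, v i) / 2 - ∑ i, u i * Real.log (2 * (u i + 1)) ≤ klPotential u v := by
  rw [klPotential, Finset.sum_div, ← Finset.sum_sub_distrib]
  refine Finset.sum_le_sum fun i _ => ?_
  linarith [mul_log_le_half_add (hu i) (hv i)]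

/-- The decrease of the Kullback–Leibler potential along one multiplier step. -/
lemma mul_sum_le_klPotential_sub {m : ℕ} {k : ℝ} {u x y c : Fin m → ℝ} (hu : ∀ i, 0 ≤ u i)
    (hx : ∀ i, 0 < x i) (hy : ∀ i, 0 < y i) (hc : ∀ i, k * c i = x i / y i - 1) :
    k * ∑ i, -c i * (u i - y i) ≤ klPotential u x - klPotential u y := by
  rw [klPotential, klPotential, ← Finset.sum_sub_distrib, Finset.mul_sum]
  refine Finset.sum_le_sum fun i _ => ?_
  have h := Real.log_le_sub_one_of_pos (div_pos (hx i) (hy i))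
  rw [Real.log_div (hx i).ne' (hy i).ne'] at h
  have hxy : x i / y i * y i = x i := div_mul_cancel₀ _ (hy i).ne'
  have hk : k * (-c i * (u i - y i)) = u i * (1 - x i / y i) + x i - y i := by
    linear_combination -(u i - y i) * hc i + hxy
  linarith [mul_le_mul_of_nonneg_left h (hu i)]

/-- **Dual convergence of the MBF multiplier method.** Let `d` be concave and continuous
with nonempty bounded set `L*` of maximizers over `ℝ^m₊`, and let strictly positive
multipliers `λ_s` evolve by the MBF update `λ_{i,s+1} = λ_{i,s}(k c_{i,s}+1)⁻¹`, where
`−c_s` is a supergradient of `d` at `λ_{s+1}`.  Then `d(λ_s)` is nondecreasing and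
converges to the optimal dual value, and asymptotic complementarity
`⟨λ_{s+1}, c_s⟩ → 0` holds. -/
theorem mbf_dual_convergence {m : ℕ}
    (d : (Fin m → ℝ) → ℝ) (hconc : ConcaveOn ℝ Set.univ d) (hcont : Continuous d)
    (Lstar : Set (Fin m → ℝ))
    (hLstar : Lstar = {μ | (∀ i, 0 ≤ μ i) ∧ ∀ ν, (∀ i, 0 ≤ ν i) → d ν ≤ d μ})
    (hne : Lstar.Nonempty) (hbd : Bornology.IsBounded Lstar)
    (k : ℝ) (hk : 0 < k)
    (lam : ℕ → Fin m → ℝ) (c : ℕ → Fin m → ℝ)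
    (hlam : ∀ s i, 0 < lam s i)
    (hupd : ∀ s i, lam (s + 1) i = lam s i * (k * c s i + 1)⁻¹)
    (hsupg : ∀ s u, (∀ i, 0 ≤ u i) →
      d u - d (lam (s + 1)) ≤ ∑ i, (-(c s i)) * (u i - lam (s + 1) i)) :
    Monotone (fun s => d (lam s)) ∧
    (∀ lamstar ∈ Lstar, Tendsto (fun s => d (lam s)) atTop (nhds (d lamstar))) ∧
    Tendsto (fun s => ∑ i, lam (s + 1) i * c s i) atTop (nhds 0) := by
  have hc : ∀ s i, k * c s i = lam s i / lam (s + 1) i - 1 := by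
    intro s i
    have hne' : k * c s i + 1 ≠ 0 := by
      intro h
      have := hlam (s + 1) i
      rw [hupd, h, inv_zero, mul_zero] at this
      exact lt_irrefl _ this
    rw [hupd s i, div_mul_eq_div_div, div_self (hlam s i).ne', one_div, inv_inv]
    ring
  have hyc : ∀ s i, lam (s + 1) i * c s i = (lam s i - lam (s + 1) i) / k := by
    intro s i
    have hy := (hlam (s + 1) i).ne'
    rw [eq_div_iff hk.ne']
    linear_combination lam (s + 1) i * hc s i + div_mul_cancel₀ (lam s i) hy
  have hterm : ∀ s i, c s i * (lam s i - lam (s + 1) i)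
      = (lam s i - lam (s + 1) i) ^ 2 / (k * lam (s + 1) i) := by
    intro s i
    rw [eq_div_iff (mul_pos hk (hlam (s + 1) i)).ne']
    have := hyc s i
    rw [eq_div_iff hk.ne'] at this
    linear_combination (lam s i - lam (s + 1) i) * this
  have hterm_nonneg : ∀ s i, 0 ≤ c s i * (lam s i - lam (s + 1) i) := by
    intro s i
    rw [hterm]
    have := hlam (s + 1) i
    positivity
  have hgain : ∀ s, ∑ i, c s i * (lam s i - lam (s + 1) i) ≤ d (lam (s + 1)) - d (lam s) := by
    intro s
    have h := hsupg s (lam s) fun i => (hlam s i).le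
    simp only [neg_mul, Finset.sum_neg_distrib] at h
    linarith
  have hmono : Monotone fun s => d (lam s) := monotone_nat_of_le_succ fun s => by
    linarith [hgain s, Finset.sum_nonneg fun i (_ : i ∈ Finset.univ) => hterm_nonneg s i]
  have hstep : ∀ u ∈ Lstar, ∀ s,
      k * (d u - d (lam (s + 1))) ≤ klPotential u (lam s) - klPotential u (lam (s + 1)) := by
    intro u hu s
    rw [hLstar] at hu
    exact (mul_le_mul_of_nonneg_left (hsupg s u hu.1) hk.le).trans
      (mul_sum_le_klPotential_sub hu.1 (hlam s) (hlam (s + 1)) (hc s))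
  have hgap : ∀ u ∈ Lstar, ∀ s, 0 ≤ d u - d (lam s) := by
    intro u hu s
    rw [hLstar] at hu
    exact sub_nonneg.2 (hu.2 _ fun i => (hlam s i).le)
  have hlim : ∀ u ∈ Lstar, Tendsto (fun s => d (lam s)) atTop (nhds (d u)) := by
    intro u hu
    have hu0 : ∀ i, 0 ≤ u i := by rw [hLstar] at hu; exact hu.1
    have hsum : Summable fun s => k * (d u - d (lam (s + 1))) := by
      refine summable_of_sum_range_le
        (c := klPotential u (lam 0) + ∑ i, u i * Real.log (2 * (u i + 1)))
        (fun s => mul_nonneg hk.le (hgap u hu _)) fun n => ?_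
      refine (Finset.sum_le_sum fun s _ => hstep u hu s).trans ?_
      rw [Finset.sum_range_sub' fun s => klPotential u (lam s)]
      linarith [half_sum_sub_le_klPotential hu0 (hlam n),
        Finset.sum_nonneg fun i (_ : i ∈ Finset.univ) => (hlam n i).le]
    have h0 := ((summable_mul_left_iff hk.ne').1 hsum).tendsto_atTop_zero
    rw [← tendsto_add_atTop_iff_nat 1]
    simpa using h0.const_sub (d u)
  refine ⟨hmono, hlim, ?_⟩
  obtain ⟨u, hu⟩ := hne
  have hu0 : ∀ i, 0 ≤ u i := by rw [hLstar] at hu; exact hu.1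
  have hanti : Antitone fun s => klPotential u (lam s) := antitone_nat_of_succ_le fun s => by
    linarith [hstep u hu s, mul_nonneg hk.le (hgap u hu (s + 1))]
  obtain ⟨B, hB⟩ : ∃ B, ∀ s i, lam s i ≤ B := by
    refine ⟨2 * (klPotential u (lam 0) + ∑ i, u i * Real.log (2 * (u i + 1))), fun s i => ?_⟩
    linarith [half_sum_sub_le_klPotential hu0 (hlam s), hanti (Nat.zero_le s),
      Finset.single_le_sum (fun j _ => (hlam s j).le) (Finset.mem_univ i)]
  have hincr : Tendsto (fun s => d (lam (s + 1)) - d (lam s)) atTop (nhds 0) := by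
    simpa using ((tendsto_add_atTop_iff_nat 1).2 (hlim u hu)).sub (hlim u hu)
  have hdiff : ∀ i, Tendsto (fun s => lam s i - lam (s + 1) i) atTop (nhds 0) := by
    intro i
    have hsq : Tendsto (fun s => (lam s i - lam (s + 1) i) ^ 2) atTop (nhds 0) := by
      refine squeeze_zero (fun s => sq_nonneg _) (fun s => ?_)
        (by simpa using hincr.mul_const (k * B))
      have hi := (Finset.single_le_sum (fun j _ => hterm_nonneg s j)
        (Finset.mem_univ i)).trans (hgain s)
      rw [hterm, div_le_iff₀ (mul_pos hk (hlam (s + 1) i))] at hi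
      exact hi.trans (mul_le_mul_of_nonneg_left
        (mul_le_mul_of_nonneg_left (hB (s + 1) i) hk.le) (sub_nonneg.2 (hmono s.le_succ)))
    rw [tendsto_zero_iff_abs_tendsto_zero]
    simpa [Function.comp_def, Real.sqrt_sq_eq_abs] using hsq.sqrt
  simp only [hyc]
  simpa using tendsto_finsetSum Finset.univ fun i _ => (hdiff i).div_const k
end

section
/- Let I ⊆ ℝ be an open interval containing [0, s] with s ≥ 0, and f : I → ℝ three times continuously differentiable with f''(t) > 0 and |f'''(t)| ≤ 2 (f''(t))^{3/2} for all t ∈ I. Then f''(s) ≥ ( (f''(0))^{−1/2} + s )^{−2}, and if moreover s < (f''(0))^{−1/2} then f''(s) ≤ ( (f''(0))^{−1/2} − s )^{−2}. -/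
/-- If `g > 0` and `|g'| ≤ 2 g^{3/2}` on a convex set, then `g^{-1/2}` is `1`-Lipschitz there. -/
theorem abs_rpow_neg_half_sub_le {g g' : ℝ → ℝ} {I : Set ℝ} (hI : Convex ℝ I)
    (hg : ∀ t ∈ I, HasDerivAt g (g' t) t) (hpos : ∀ t ∈ I, 0 < g t)
    (hbound : ∀ t ∈ I, |g' t| ≤ 2 * g t ^ ((3 : ℝ) / 2)) {x y : ℝ} (hx : x ∈ I) (hy : y ∈ I) :
    |g y ^ ((-1 : ℝ) / 2) - g x ^ ((-1 : ℝ) / 2)| ≤ |y - x| := by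
  have hderiv : ∀ t ∈ I, HasDerivWithinAt (fun t => g t ^ ((-1 : ℝ) / 2))
      (g' t * ((-1 : ℝ) / 2) * g t ^ ((-1 : ℝ) / 2 - 1)) I t := fun t ht =>
    ((hg t ht).rpow_const (Or.inl (hpos t ht).ne')).hasDerivWithinAt
  have hle : ∀ t ∈ I, ‖g' t * ((-1 : ℝ) / 2) * g t ^ ((-1 : ℝ) / 2 - 1)‖ ≤ 1 := by
    intro t ht
    have hp : 0 < g t ^ ((-1 : ℝ) / 2 - 1) := Real.rpow_pos_of_pos (hpos t ht) _
    have hmul : g t ^ ((3 : ℝ) / 2) * g t ^ ((-1 : ℝ) / 2 - 1) = 1 := by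
      rw [← Real.rpow_add (hpos t ht)]
      norm_num
    rw [Real.norm_eq_abs, abs_mul, abs_mul, abs_of_pos hp,
      show |(-1 : ℝ) / 2| = 1 / 2 by norm_num [abs_div]]
    nlinarith [mul_le_mul_of_nonneg_right (hbound t ht) hp.le]
  simpa using hI.norm_image_sub_le_of_norm_hasDerivWithin_le hderiv hle hx hy

/-- Raising to the power `-1/2` and then to the power `-2` is the identity on positive reals. -/
theorem rpow_neg_half_rpow_neg_two {a : ℝ} (ha : 0 < a) :
    (a ^ ((-1 : ℝ) / 2)) ^ (-2 : ℝ) = a := by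
  rw [← Real.rpow_mul ha.le]
  norm_num

/-- **Second-derivative bounds for self-concordant functions of one variable.**
If `f` is `C³` on an open interval `I ⊇ [0,s]` with `f'' > 0` and
`|f'''| ≤ 2 (f'')^{3/2}` on `I`, then
`f''(s) ≥ ((f''(0))^{−1/2} + s)^{−2}`, and if `s < (f''(0))^{−1/2}` also
`f''(s) ≤ ((f''(0))^{−1/2} − s)^{−2}`. -/
theorem sc_second_derivative_bounds (s : ℝ) (hs : 0 ≤ s)
    (I : Set ℝ) (hIopen : IsOpen I) (hIconv : Convex ℝ I) (hIcc : Set.Icc 0 s ⊆ I)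
    (f : ℝ → ℝ) (hf : ContDiffOn ℝ 3 f I)
    (hf'' : ∀ t ∈ I, 0 < deriv (deriv f) t)
    (hsc : ∀ t ∈ I, |deriv (deriv (deriv f)) t| ≤ 2 * (deriv (deriv f) t) ^ ((3 : ℝ) / 2)) :
    deriv (deriv f) s ≥ ((deriv (deriv f) 0) ^ ((-1 : ℝ) / 2) + s) ^ (-2 : ℝ) ∧
    (s < (deriv (deriv f) 0) ^ ((-1 : ℝ) / 2) →
      deriv (deriv f) s ≤ ((deriv (deriv f) 0) ^ ((-1 : ℝ) / 2) - s) ^ (-2 : ℝ)) := by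
  have hf2 : ContDiffOn ℝ 1 (deriv (deriv f)) I :=
    (hf.deriv_of_isOpen (m := 2) hIopen (by norm_num)).deriv_of_isOpen hIopen (by norm_num)
  have h0 : (0 : ℝ) ∈ I := hIcc ⟨le_rfl, hs⟩
  have hsI : s ∈ I := hIcc ⟨hs, le_rfl⟩
  have hderiv : ∀ t ∈ I, HasDerivAt (deriv (deriv f)) (deriv (deriv (deriv f)) t) t := fun t ht =>
    ((hf2.differentiableOn one_ne_zero).differentiableAt (hIopen.mem_nhds ht)).hasDerivAt
  have hlip := abs_rpow_neg_half_sub_le hIconv hderiv hf'' hsc h0 hsI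
  rw [sub_zero, abs_of_nonneg hs, abs_le] at hlip
  have hpos : 0 < deriv (deriv f) s ^ ((-1 : ℝ) / 2) := Real.rpow_pos_of_pos (hf'' s hsI) _
  have hinv := rpow_neg_half_rpow_neg_two (hf'' s hsI)
  refine ⟨?_, fun hlt => ?_⟩
  · rw [ge_iff_le, ← hinv]
    exact Real.rpow_le_rpow_of_nonpos hpos (by linarith) (by norm_num)
  · rw [← hinv]
    exact Real.rpow_le_rpow_of_nonpos (by linarith) (by linarith) (by norm_num)
end

section
/- Let E be a finite-dimensional real inner product space and F : E → ℝ∪{+∞} a closed convex function, three times continuously differentiable on its open convex effective domain dom F, with positive definite Hessian ∇²F(x) at every x ∈ dom F, and self-concordant with M = 2: |D³F(x)[u,u,u]| ≤ 2 (⟨∇²F(x)u,u⟩)^{3/2} for all x ∈ dom F, u ∈ E. Then for all x, y ∈ dom F: ‖y − x‖_y ≥ ‖y − x‖_x / (1 + ‖y − x‖_x), and if ‖y − x‖_x < 1 then ‖y − x‖_y ≤ ‖y − x‖_x / (1 − ‖y − x‖_x). -/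
open scoped Classical

/-- The Hessian quadratic form `⟨∇²F(x)u, u⟩` of `F` at `x` in direction `u`. -/
noncomputable def hessQ {E : Type*} [NormedAddCommGroup E] [NormedSpace ℝ E]
    (F : E → ℝ) (x u : E) : ℝ :=
  iteratedFDeriv ℝ 2 F x ![u, u]

/-- The third directional derivative `D³F(x)[u,u,u]`. -/
noncomputable def thirdD {E : Type*} [NormedAddCommGroup E] [NormedSpace ℝ E]
    (F : E → ℝ) (x u : E) : ℝ :=
  iteratedFDeriv ℝ 3 F x ![u, u, u]

/-- The local norm `‖u‖_x = ⟨∇²F(x)u, u⟩^{1/2}`. -/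
noncomputable def locNorm {E : Type*} [NormedAddCommGroup E] [NormedSpace ℝ E]
    (F : E → ℝ) (x u : E) : ℝ :=
  Real.sqrt (hessQ F x u)

theorem hasDerivAt_hessQ_comp_line {E : Type*} [NormedAddCommGroup E] [NormedSpace ℝ E]
    {F : E → ℝ} {x u : E} {t : ℝ} (hF : ContDiffAt ℝ 3 F (x + t • u)) :
    HasDerivAt (fun s : ℝ => hessQ F (x + s • u) u) (thirdD F (x + t • u) u) t := by
  have hd : DifferentiableAt ℝ (iteratedFDeriv ℝ 2 F) (x + t • u) :=
    hF.differentiableAt_iteratedFDeriv (by norm_num)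
  have hline : HasDerivAt (fun s : ℝ => x + s • u) u t := by
    simpa using ((hasDerivAt_id t).smul_const u).const_add x
  have hcomp := hd.hasFDerivAt.comp_hasDerivAt t hline
  exact (ContinuousMultilinearMap.apply ℝ (fun _ : Fin 2 => E) ℝ
    ![u, u]).hasFDerivAt.comp_hasDerivAt t hcomp

/-- Along a line inside the domain, the reciprocal local norm of the direction of a self-concordant
function is `1`-Lipschitz. -/
theorem abs_inv_locNorm_sub_le {E : Type*} [NormedAddCommGroup E] [NormedSpace ℝ E]
    {D : Set E} (hDo : IsOpen D) (hDc : Convex ℝ D) {F : E → ℝ} (hF : ContDiffOn ℝ 3 F D)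
    (hsc : ∀ x ∈ D, ∀ u : E, |thirdD F x u| ≤ 2 * (hessQ F x u) ^ ((3 : ℝ) / 2))
    {x y : E} (hx : x ∈ D) (hy : y ∈ D) (hpos : ∀ z ∈ D, 0 < hessQ F z (y - x)) :
    |(locNorm F y (y - x))⁻¹ - (locNorm F x (y - x))⁻¹| ≤ 1 := by
  set u := y - x with hu
  have hmem : ∀ t ∈ Set.Icc (0 : ℝ) 1, x + t • u ∈ D := fun t ht =>
    hDc.add_smul_sub_mem hx hy ht
  have key : ∀ t ∈ Set.Icc (0 : ℝ) 1, ∃ d : ℝ,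
      HasDerivAt (fun s : ℝ => (locNorm F (x + s • u) u)⁻¹) d t ∧ |d| ≤ 1 := by
    intro t ht
    have hz := hmem t ht
    have hq := hpos _ hz
    have hr := Real.sqrt_pos.mpr hq
    refine ⟨_, ((hasDerivAt_hessQ_comp_line (hF.contDiffAt (hDo.mem_nhds hz))).sqrt
      hq.ne').inv hr.ne', ?_⟩
    have h3 := hsc _ hz u
    have hpow : hessQ F (x + t • u) u ^ ((3 : ℝ) / 2) = √(hessQ F (x + t • u) u) ^ 3 := by
      rw [Real.sqrt_eq_rpow, ← Real.rpow_natCast, ← Real.rpow_mul hq.le]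
      norm_num
    rw [hpow] at h3
    rw [abs_div, abs_neg, abs_div, abs_of_pos (pow_pos hr 2), abs_of_pos (mul_pos two_pos hr),
      div_div, div_le_one (by positivity)]
    linarith
  choose! d hd hd1 using key
  have h := (convex_Icc (0 : ℝ) 1).norm_image_sub_le_of_norm_hasDerivWithin_le
    (C := 1) (fun t ht => (hd t ht).hasDerivWithinAt) hd1
    (Set.left_mem_Icc.mpr zero_le_one) (Set.right_mem_Icc.mpr zero_le_one)
  simpa [hu] using h

/-- **Local norm comparison for self-concordant functions.** For a self-concordant `F`
(with `M = 2`) and `x, y ∈ dom F`, one has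
`‖y−x‖_y ≥ ‖y−x‖_x/(1+‖y−x‖_x)`, and `‖y−x‖_y ≤ ‖y−x‖_x/(1−‖y−x‖_x)` when
`‖y−x‖_x < 1`. -/
theorem sc_local_norm_comparison {E : Type*} [NormedAddCommGroup E]
    [InnerProductSpace ℝ E] [FiniteDimensional ℝ E]
    (D : Set E) (hDo : IsOpen D) (hDc : Convex ℝ D)
    (F : E → ℝ)
    (hclosed : LowerSemicontinuous (fun x => if x ∈ D then (F x : EReal) else ⊤))
    (hconv : ConvexOn ℝ D F)
    (hF : ContDiffOn ℝ 3 F D)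
    (hpos : ∀ x ∈ D, ∀ u : E, u ≠ 0 → 0 < hessQ F x u)
    (hsc : ∀ x ∈ D, ∀ u : E, |thirdD F x u| ≤ 2 * (hessQ F x u) ^ ((3 : ℝ) / 2)) :
    ∀ x ∈ D, ∀ y ∈ D,
      locNorm F y (y - x) ≥ locNorm F x (y - x) / (1 + locNorm F x (y - x)) ∧
      (locNorm F x (y - x) < 1 →
        locNorm F y (y - x) ≤ locNorm F x (y - x) / (1 - locNorm F x (y - x))) := by
  intro x hx y hy
  rcases eq_or_ne x y with rfl | hxy
  · have h0 : locNorm F x (x - x) = 0 := by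
      rw [locNorm, hessQ, (iteratedFDeriv ℝ 2 F x).map_coord_zero 0 (by simp), Real.sqrt_zero]
    rw [h0]
    norm_num
  have hp : ∀ z ∈ D, 0 < hessQ F z (y - x) := fun z hz => hpos z hz _ (sub_ne_zero.mpr hxy.symm)
  have h := abs_le.mp (abs_inv_locNorm_sub_le hDo hDc hF hsc hx hy hp)
  have ha : 0 < locNorm F x (y - x) := Real.sqrt_pos.mpr (hp x hx)
  have hb : 0 < locNorm F y (y - x) := Real.sqrt_pos.mpr (hp y hy)
  generalize locNorm F x (y - x) = a at *
  generalize locNorm F y (y - x) = b at *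
  obtain ⟨h1, h2⟩ := h
  have e : b⁻¹ - a⁻¹ = (a - b) / (a * b) := by field_simp
  rw [e, le_div_iff₀ (by positivity)] at h1
  rw [e, div_le_iff₀ (by positivity)] at h2
  refine ⟨?_, fun h => ?_⟩
  · rw [ge_iff_le, div_le_iff₀ (by positivity)]
    linarith
  · rw [le_div_iff₀ (by linarith)]
    linarith
end

section
/- Let E be a finite-dimensional real inner product space and F : E → ℝ∪{+∞} a closed convex function, three times continuously differentiable on its open convex effective domain dom F, with positive definite Hessian ∇²F(x) at every x ∈ dom F, and self-concordant with M = 2: |D³F(x)[u,u,u]| ≤ 2 (⟨∇²F(x)u,u⟩)^{3/2} for all x ∈ dom F, u ∈ E. Then for every x ∈ dom F and every r with 0 ≤ r < 1, the Dikin ellipsoid E(x, r) = { y ∈ E : ‖y − x‖_x ≤ r } is contained in dom F. -/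
open scoped Classical

/-- Along a line, the `n`-th derivative in the direction of the line has the `(n + 1)`-st one as
its derivative. -/
theorem hasDerivAt_iteratedFDeriv_line {E : Type*} [NormedAddCommGroup E] [NormedSpace ℝ E]
    {F : E → ℝ} {x u : E} {t : ℝ} {n : ℕ} (h : ContDiffAt ℝ (n + 1 : ℕ) F (x + t • u)) :
    HasDerivAt (fun s : ℝ => iteratedFDeriv ℝ n F (x + s • u) (fun _ => u))
      (iteratedFDeriv ℝ (n + 1) F (x + t • u) (fun _ => u)) t := by
  have hd : DifferentiableAt ℝ (iteratedFDeriv ℝ n F) (x + t • u) :=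
    h.differentiableAt_iteratedFDeriv (by exact_mod_cast Nat.lt_succ_self n)
  have hl : HasDerivAt (fun s : ℝ => x + s • u) u t := by
    simpa using ((hasDerivAt_id t).smul_const u).const_add x
  have hc := hd.hasFDerivAt.comp_hasDerivAt t hl
  have := ((ContinuousMultilinearMap.apply ℝ (fun _ : Fin n => E) ℝ
    (fun _ => u)).hasFDerivAt).comp_hasDerivAt t hc
  rw [iteratedFDeriv_succ_apply_left]
  exact this

/-- A positive function on `[0, T)` with `|q'| ≤ 2 q ^ (3 / 2)`, `q 0 < 1` and `T ≤ 1` is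
bounded. -/
theorem exists_bound_of_abs_deriv_le_rpow {q q' : ℝ → ℝ} {T : ℝ} (hT : 0 < T) (hT1 : T ≤ 1)
    (hd : ∀ t ∈ Set.Ico 0 T, HasDerivAt q (q' t) t) (hp : ∀ t ∈ Set.Ico 0 T, 0 < q t)
    (hq : ∀ t ∈ Set.Ico 0 T, |q' t| ≤ 2 * q t ^ ((3 : ℝ) / 2)) (h0 : q 0 < 1) :
    ∃ K, ∀ t ∈ Set.Ico 0 T, q t ≤ K := by
  have m0 : (0 : ℝ) ∈ Set.Ico 0 T := ⟨le_rfl, hT⟩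
  have hg : 1 < q 0 ^ (-(1 / 2) : ℝ) :=
    Real.one_lt_rpow_of_pos_of_lt_one_of_neg (hp 0 m0) h0 (by norm_num)
  set δ := q 0 ^ (-(1 / 2) : ℝ) - 1 with hδ
  have δpos : 0 < δ := by linarith
  refine ⟨δ ^ (-2 : ℝ), fun t ht => ?_⟩
  have key := (convex_Ico (0 : ℝ) T).norm_image_sub_le_of_norm_hasDerivWithin_le
    (f := fun t => q t ^ (-(1 / 2) : ℝ)) (C := 1)
    (fun s hs => ((hd s hs).rpow_const (p := -(1 / 2)) (Or.inl (hp s hs).ne')).hasDerivWithinAt)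
    (fun s hs => by
      have hmul : q s ^ ((3 : ℝ) / 2) * q s ^ (-(1 / 2) - 1 : ℝ) = 1 := by
        rw [← Real.rpow_add (hp s hs)]
        norm_num
      have hr : 0 < q s ^ (-(1 / 2) - 1 : ℝ) := Real.rpow_pos_of_pos (hp s hs) _
      rw [Real.norm_eq_abs, abs_mul, abs_mul, abs_of_pos hr]
      have habs : |(-(1 / 2) : ℝ)| = 1 / 2 := by norm_num
      rw [habs]
      nlinarith [mul_le_mul_of_nonneg_right (hq s hs) hr.le])
    m0 ht
  simp only [Real.norm_eq_abs, sub_zero, one_mul, abs_of_nonneg ht.1] at key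
  have hle : δ ≤ q t ^ (-(1 / 2) : ℝ) := by linarith [(abs_le.1 key).1, ht.2]
  have hqt : q t = (q t ^ (-(1 / 2) : ℝ)) ^ (-2 : ℝ) := by
    rw [← Real.rpow_mul (hp t ht).le]
    norm_num
  rw [hqt]
  exact Real.rpow_le_rpow_of_nonpos δpos hle (by norm_num)

/-- A function whose derivative is bounded on `[0, T)` is bounded there. -/
theorem exists_bound_of_abs_deriv_le {f f' : ℝ → ℝ} {T K : ℝ} (hT : 0 < T)
    (hd : ∀ t ∈ Set.Ico 0 T, HasDerivAt f (f' t) t) (hK : ∀ t ∈ Set.Ico 0 T, |f' t| ≤ K) :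
    ∃ C, ∀ t ∈ Set.Ico 0 T, |f t| ≤ C := by
  have m0 : (0 : ℝ) ∈ Set.Ico 0 T := ⟨le_rfl, hT⟩
  have hK0 : 0 ≤ K := (abs_nonneg _).trans (hK 0 m0)
  refine ⟨|f 0| + K * T, fun t ht => ?_⟩
  have key := (convex_Ico (0 : ℝ) T).norm_image_sub_le_of_norm_hasDerivWithin_le
    (fun s hs => (hd s hs).hasDerivWithinAt) hK m0 ht
  simp only [Real.norm_eq_abs, sub_zero, abs_of_nonneg ht.1] at key
  have h1 : |f t| ≤ |f t - f 0| + |f 0| := by simpa using abs_add_le (f t - f 0) (f 0)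
  linarith [mul_le_mul_of_nonneg_left ht.2.le hK0]

/-- **Dikin ellipsoids lie in the domain.** For a self-concordant `F` (with `M = 2`),
every Dikin ellipsoid `E(x,r) = {y : ‖y−x‖_x ≤ r}` with `0 ≤ r < 1` is contained in
`dom F`. -/
theorem sc_dikin_ellipsoid_subset {E : Type*} [NormedAddCommGroup E]
    [InnerProductSpace ℝ E] [FiniteDimensional ℝ E]
    (D : Set E) (hDo : IsOpen D) (hDc : Convex ℝ D)
    (F : E → ℝ)
    (hclosed : LowerSemicontinuous (fun x => if x ∈ D then (F x : EReal) else ⊤))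
    (hconv : ConvexOn ℝ D F)
    (hF : ContDiffOn ℝ 3 F D)
    (hpos : ∀ x ∈ D, ∀ u : E, u ≠ 0 → 0 < hessQ F x u)
    (hsc : ∀ x ∈ D, ∀ u : E, |thirdD F x u| ≤ 2 * (hessQ F x u) ^ ((3 : ℝ) / 2)) :
    ∀ x ∈ D, ∀ r : ℝ, 0 ≤ r → r < 1 → {y : E | locNorm F x (y - x) ≤ r} ⊆ D := by
  intro x hx r hr0 hr1 y hy
  by_contra hyD
  set u := y - x with hu
  have hu0 : u ≠ 0 := by
    intro h
    rw [sub_eq_zero.1 (hu.symm.trans h)] at hyD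
    exact hyD hx
  have hcont : Continuous fun t : ℝ => x + t • u := by fun_prop
  have hScl : IsCompact (Set.Icc (0 : ℝ) 1 ∩ (fun t : ℝ => x + t • u) ⁻¹' Dᶜ) :=
    isCompact_Icc.inter_right (hDo.isClosed_compl.preimage hcont)
  obtain ⟨T, ⟨⟨hT0, hT1⟩, hTD⟩, hTmin⟩ :=
    hScl.exists_isLeast ⟨1, ⟨zero_le_one, le_rfl⟩, by simpa [hu] using hyD⟩
  have hTpos : 0 < T := hT0.lt_of_ne (by
    rintro rfl
    simp [hx] at hTD)
  have hmem : ∀ t ∈ Set.Ico 0 T, x + t • u ∈ D := fun t ht => by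
    by_contra h
    exact absurd (hTmin ⟨⟨ht.1, ht.2.le.trans hT1⟩, h⟩) (not_le.2 ht.2)
  have hcd : ∀ t ∈ Set.Ico 0 T, ContDiffAt ℝ 3 F (x + t • u) := fun t ht =>
    hF.contDiffAt (hDo.mem_nhds (hmem t ht))
  have hvec2 : (![u, u] : Fin 2 → E) = fun _ => u := by
    ext i
    fin_cases i <;> rfl
  have hd2 : ∀ t ∈ Set.Ico 0 T,
      HasDerivAt (fun s : ℝ => hessQ F (x + s • u) u) (thirdD F (x + t • u) u) t := by
    intro t ht
    simp only [hessQ, thirdD, hvec2]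
    exact hasDerivAt_iteratedFDeriv_line ((hcd t ht).of_le (by norm_num))
  have hd1 : ∀ t ∈ Set.Ico 0 T,
      HasDerivAt (fun s : ℝ => iteratedFDeriv ℝ 1 F (x + s • u) fun _ => u)
        (hessQ F (x + t • u) u) t := by
    intro t ht
    simp only [hessQ, hvec2]
    exact hasDerivAt_iteratedFDeriv_line ((hcd t ht).of_le (by norm_num))
  have hd0 : ∀ t ∈ Set.Ico 0 T, HasDerivAt (fun s : ℝ => F (x + s • u))
      (iteratedFDeriv ℝ 1 F (x + t • u) fun _ => u) t := by
    intro t ht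
    simpa only [iteratedFDeriv_zero_apply] using
      hasDerivAt_iteratedFDeriv_line (n := 0) ((hcd t ht).of_le (by norm_num))
  have hq0 : hessQ F (x + (0 : ℝ) • u) u < 1 := by
    have hlt : Real.sqrt (hessQ F x u) < 1 := lt_of_le_of_lt hy hr1
    rw [zero_smul, add_zero]
    simpa using (Real.sqrt_lt' one_pos).1 hlt
  have hp : ∀ t ∈ Set.Ico 0 T, 0 < hessQ F (x + t • u) u := fun t ht =>
    hpos _ (hmem t ht) u hu0
  obtain ⟨K, hK⟩ := exists_bound_of_abs_deriv_le_rpow hTpos hT1 hd2 hp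
    (fun t ht => hsc _ (hmem t ht) u) hq0
  obtain ⟨K₁, hK₁⟩ := exists_bound_of_abs_deriv_le hTpos hd1
    (fun t ht => (abs_of_pos (hp t ht)).trans_le (hK t ht))
  obtain ⟨C, hC⟩ := exists_bound_of_abs_deriv_le hTpos hd0 hK₁
  have hev : ∀ᶠ z in nhds (x + T • u), (C : EReal) < if z ∈ D then (F z : EReal) else ⊤ :=
    hclosed (x + T • u) C (by
      change (C : EReal) < if x + T • u ∈ D then _ else _
      rw [if_neg hTD]
      exact EReal.coe_lt_top C)
  have hev' := (hcont.tendsto T).eventually hev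
  obtain ⟨t, ht, htm⟩ := ((hev'.filter_mono nhdsWithin_le_nhds).and
    (Ico_mem_nhdsLT hTpos)).exists
  rw [if_pos (hmem t htm), EReal.coe_lt_coe_iff] at ht
  exact absurd ((le_abs_self _).trans (hC t htm)) (not_le.2 ht)
end

section
/- Let E be a finite-dimensional real inner product space and F : E → ℝ∪{+∞} a closed convex function, three times continuously differentiable on its open convex effective domain dom F, with positive definite Hessian ∇²F(x) at every x ∈ dom F, and self-concordant with M = 2: |D³F(x)[u,u,u]| ≤ 2 (⟨∇²F(x)u,u⟩)^{3/2} for all x ∈ dom F, u ∈ E. Then for all x, y ∈ dom F with r = ‖y − x‖_x < 1 and all u ∈ E: (1 − r)² ⟨∇²F(x)u,u⟩ ≤ ⟨∇²F(y)u,u⟩ ≤ (1 − r)^{−2} ⟨∇²F(x)u,u⟩. -/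
open scoped Classical

/-- Interpolation formula for a polarized binary cubic form: it is a combination, with nonnegative
weights, of diagonal values at three points of the unit circle at mutual angle `2π/3`. -/
theorem cubic_quadrature {c s q : ℝ} (hq : q ^ 2 = 3) (hcs : c ^ 2 + s ^ 2 = 1) (A B C D : ℝ) :
    let p : ℝ → ℝ → ℝ := fun x y => x ^ 3 * A + x ^ 2 * y * B + x * y ^ 2 * C + y ^ 3 * D
    let w : ℝ → ℝ → ℝ := fun x y => (3 * x ^ 2 - y ^ 2) ^ 2 / 9
    (4 * c ^ 3 - 3 * c) * A + (3 * s - 4 * s ^ 3) * (B / 3) =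
      w c s * p c s + w (-(c + q * s) / 2) ((q * c - s) / 2) * p (-(c + q * s) / 2) ((q * c - s) / 2)
        + w (-(c - q * s) / 2) (-(q * c + s) / 2) * p (-(c - q * s) / 2) (-(q * c + s) / 2) := by
  intro p w
  have h1 : 4 * c ^ 3 - 3 * c = (c ^ 3 - 3 * c * s ^ 2) * (c ^ 2 + s ^ 2) ^ 2 := by
    rw [hcs]; linear_combination 3 * c * hcs
  have h2 : 3 * s - 4 * s ^ 3 = (3 * c ^ 2 * s - s ^ 3) * (c ^ 2 + s ^ 2) ^ 2 := by
    rw [hcs]; linear_combination -3 * s * hcs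
  have q4 : q ^ 4 = 9 := by rw [show q ^ 4 = (q ^ 2) ^ 2 by ring, hq]; norm_num
  have q6 : q ^ 6 = 27 := by rw [show q ^ 6 = (q ^ 2) ^ 3 by ring, hq]; norm_num
  rw [h1, h2]
  simp only [p, w]
  ring_nf
  rw [hq, q4, q6]
  ring

/-- The weights of `cubic_quadrature` add up to one. -/
theorem cubic_quadrature_weights {c s q : ℝ} (hq : q ^ 2 = 3) (hcs : c ^ 2 + s ^ 2 = 1) :
    let w : ℝ → ℝ → ℝ := fun x y => (3 * x ^ 2 - y ^ 2) ^ 2 / 9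
    w c s + w (-(c + q * s) / 2) ((q * c - s) / 2) + w (-(c - q * s) / 2) (-(q * c + s) / 2) = 1 := by
  intro w
  have q4 : q ^ 4 = 9 := by rw [show q ^ 4 = (q ^ 2) ^ 2 by ring, hq]; norm_num
  rw [show (1:ℝ) = (c ^ 2 + s ^ 2) ^ 2 by rw [hcs]; norm_num]
  simp only [w]
  ring_nf
  rw [hq, q4]
  ring

section

variable {E : Type*} [NormedAddCommGroup E] [NormedSpace ℝ E]

theorem abs_trilinear_le_of_orthogonal (T : E →L[ℝ] E →L[ℝ] E →L[ℝ] ℝ) (B : E →L[ℝ] E →L[ℝ] ℝ)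
    (hT₁ : ∀ a b c, T a b c = T b a c) (hT₂ : ∀ a b c, T a b c = T a c b)
    (hB : ∀ a b, B a b = B b a) {K : ℝ}
    (hK : ∀ v, B v v ≤ 1 → |T v v v| ≤ K) {u e : E} (hu : B u u = 1) (hue : B u e = 0)
    (he : B e e ≤ 1) (δ : ℝ) :
    |T (Real.cos δ • u + Real.sin δ • e) u u| ≤ K := by
  obtain ⟨c, s, hcs, hc, hs⟩ : ∃ c s : ℝ, c ^ 2 + s ^ 2 = 1 ∧
      Real.cos δ = 4 * c ^ 3 - 3 * c ∧ Real.sin δ = 3 * s - 4 * s ^ 3 := by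
    refine ⟨Real.cos (δ / 3), Real.sin (δ / 3), Real.cos_sq_add_sin_sq _, ?_, ?_⟩
    · rw [← Real.cos_three_mul]; congr 1; ring
    · rw [← Real.sin_three_mul]; congr 1; ring
  have hq : (Real.sqrt 3) ^ 2 = 3 := Real.sq_sqrt (by norm_num)
  generalize Real.sqrt 3 = q at hq
  have hp : ∀ x y : ℝ, x ^ 2 + y ^ 2 = 1 →
      |x ^ 3 * T u u u + x ^ 2 * y * (3 * T e u u) + x * y ^ 2 * (3 * T e e u)
        + y ^ 3 * T e e e| ≤ K := by
    intro x y hxy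
    have h1 : B (x • u + y • e) (x • u + y • e) ≤ 1 := by
      have : B e u = 0 := by rw [hB, hue]
      simp only [map_add, map_smul, _root_.add_apply, _root_.smul_apply, smul_eq_mul, hu,
        hue, this]
      nlinarith [mul_le_mul_of_nonneg_left he (sq_nonneg y)]
    convert hK _ h1 using 2
    simp only [map_add, map_smul, _root_.add_apply, _root_.smul_apply, smul_eq_mul]
    rw [hT₂ u u e, hT₁ u e u, hT₂ e u e, hT₁ u e e, hT₂ e u e]
    ring
  have hquad := cubic_quadrature hq hcs (T u u u) (3 * T e u u) (3 * T e e u) (T e e e)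
  have hw := cubic_quadrature_weights hq hcs
  have p₁ := hp c s hcs
  have p₂ := hp (-(c + q * s) / 2) ((q * c - s) / 2)
    (by linear_combination hcs + (c ^ 2 + s ^ 2) / 4 * hq)
  have p₃ := hp (-(c - q * s) / 2) (-(q * c + s) / 2)
    (by linear_combination hcs + (c ^ 2 + s ^ 2) / 4 * hq)
  have hL : T (Real.cos δ • u + Real.sin δ • e) u u =
      (4 * c ^ 3 - 3 * c) * T u u u + (3 * s - 4 * s ^ 3) * (3 * T e u u / 3) := by
    simp only [map_add, map_smul, _root_.add_apply, _root_.smul_apply, smul_eq_mul, hc, hs]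
    ring
  rw [hL, hquad]
  have key : ∀ w₁ w₂ w₃ a₁ a₂ a₃ : ℝ, 0 ≤ w₁ → 0 ≤ w₂ → 0 ≤ w₃ → w₁ + w₂ + w₃ = 1 →
      |a₁| ≤ K → |a₂| ≤ K → |a₃| ≤ K → |w₁ * a₁ + w₂ * a₂ + w₃ * a₃| ≤ K := by
    intro w₁ w₂ w₃ a₁ a₂ a₃ h₁ h₂ h₃ h k₁ k₂ k₃
    calc |w₁ * a₁ + w₂ * a₂ + w₃ * a₃| ≤ |w₁ * a₁| + |w₂ * a₂| + |w₃ * a₃| := abs_add_three _ _ _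
      _ = w₁ * |a₁| + w₂ * |a₂| + w₃ * |a₃| := by
        rw [abs_mul, abs_mul, abs_mul, abs_of_nonneg h₁, abs_of_nonneg h₂, abs_of_nonneg h₃]
      _ ≤ w₁ * K + w₂ * K + w₃ * K := by gcongr
      _ = K := by rw [← add_mul, ← add_mul, h, one_mul]
  exact key _ _ _ _ _ _ (by positivity) (by positivity) (by positivity) hw p₁ p₂ p₃

theorem abs_trilinear_le_of_unit (T : E →L[ℝ] E →L[ℝ] E →L[ℝ] ℝ) (B : E →L[ℝ] E →L[ℝ] ℝ)
    (hT₁ : ∀ a b c, T a b c = T b a c) (hT₂ : ∀ a b c, T a b c = T a c b)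
    (hB : ∀ a b, B a b = B b a) (hpos : ∀ v, v ≠ 0 → 0 < B v v) {K : ℝ}
    (hK : ∀ v, B v v ≤ 1 → |T v v v| ≤ K) {u h : E} (hu : B u u = 1) (hh : B h h = 1) :
    |T h u u| ≤ K := by
  have hnn : ∀ v, 0 ≤ B v v := fun v => by
    rcases eq_or_ne v 0 with rfl | hv
    · simp
    · exact (hpos v hv).le
  set x := B u h with hx
  have hx' : B h u = x := hB h u
  have hsub : B (h - x • u) (h - x • u) = 1 - x ^ 2 := by
    simp only [map_sub, map_smul, _root_.sub_apply, _root_.smul_apply, smul_eq_mul, hu,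
      hh, hx', ← hx]
    ring
  have hx1 : 0 ≤ 1 - x ^ 2 := hsub ▸ hnn _
  have hc : Real.cos (Real.arccos x) = x := Real.cos_arccos (by nlinarith) (by nlinarith)
  have hs : Real.sin (Real.arccos x) = Real.sqrt (1 - x ^ 2) := Real.sin_arccos x
  have hσ := Real.sq_sqrt hx1
  set σ := Real.sqrt (1 - x ^ 2)
  by_cases h0 : σ = 0
  · have hz : h - x • u = 0 := by
      by_contra hne
      have := hpos _ hne
      rw [hsub, ← hσ, h0] at this
      norm_num at this
    have := abs_trilinear_le_of_orthogonal T B hT₁ hT₂ hB hK hu (e := 0) (by simp) (by simp)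
      (Real.arccos x)
    rwa [hc, smul_zero, add_zero, ← sub_eq_zero.mp hz] at this
  · have hue : B u (σ⁻¹ • (h - x • u)) = 0 := by
      simp [hu, ← hx]
    have hee : B (σ⁻¹ • (h - x • u)) (σ⁻¹ • (h - x • u)) = 1 := by
      rw [map_smul, map_smul, _root_.smul_apply, hsub, ← hσ, smul_eq_mul, smul_eq_mul]
      field_simp
    have := abs_trilinear_le_of_orthogonal T B hT₁ hT₂ hB hK hu hue hee.le (Real.arccos x)
    rwa [hc, hs, smul_inv_smul₀ h0, add_sub_cancel] at this

/-- Banach's theorem: a symmetric trilinear form attains its norm, with respect to an inner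
product, on the diagonal. -/
theorem abs_trilinear_le (T : E →L[ℝ] E →L[ℝ] E →L[ℝ] ℝ) (B : E →L[ℝ] E →L[ℝ] ℝ)
    (hT₁ : ∀ a b c, T a b c = T b a c) (hT₂ : ∀ a b c, T a b c = T a c b)
    (hB : ∀ a b, B a b = B b a) (hpos : ∀ v, v ≠ 0 → 0 < B v v) {K : ℝ} (hK0 : 0 ≤ K)
    (hK : ∀ v, |T v v v| ≤ K * Real.sqrt (B v v) ^ 3) (h u : E) :
    |T h u u| ≤ K * Real.sqrt (B h h) * B u u := by
  rcases eq_or_ne u 0 with rfl | hu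
  · simp
  rcases eq_or_ne h 0 with rfl | hh
  · simp
  have hunit : ∀ v, v ≠ 0 → ∃ w, v = Real.sqrt (B v v) • w ∧ B w w = 1 := by
    intro v hv
    have h1 := Real.sqrt_pos.mpr (hpos v hv)
    have h2 := Real.sq_sqrt (hpos v hv).le
    refine ⟨(Real.sqrt (B v v))⁻¹ • v, (smul_inv_smul₀ h1.ne' v).symm, ?_⟩
    rw [map_smul, map_smul, _root_.smul_apply, smul_eq_mul, smul_eq_mul]
    nth_rewrite 3 [← h2]
    field_simp
  have hK1 : ∀ v, B v v ≤ 1 → |T v v v| ≤ K := fun v hv => by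
    refine (hK v).trans (mul_le_of_le_one_right hK0 (pow_le_one₀ (Real.sqrt_nonneg _) ?_))
    exact Real.sqrt_le_one.mpr hv
  obtain ⟨u', hu', hu1⟩ := hunit u hu
  obtain ⟨h', hh', hh1⟩ := hunit h hh
  have := abs_trilinear_le_of_unit T B hT₁ hT₂ hB hpos hK1 hu1 hh1
  have hα := Real.sq_sqrt (hpos u hu).le
  have hα0 := Real.sqrt_nonneg (B u u)
  have hβ0 := Real.sqrt_nonneg (B h h)
  rw [← hα]
  generalize Real.sqrt (B u u) = α at *
  generalize Real.sqrt (B h h) = β at *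
  have hT : T h u u = β * α ^ 2 * T h' u' u' := by
    rw [hu', hh']
    simp only [map_smul, _root_.smul_apply, smul_eq_mul]
    ring
  rw [hT, abs_mul, abs_of_nonneg (by positivity)]
  calc β * α ^ 2 * |T h' u' u'| ≤ β * α ^ 2 * K := by gcongr
    _ = K * β * α ^ 2 := by ring

theorem iteratedFDeriv_three_apply (F : E → ℝ) (x a b c : E) :
    iteratedFDeriv ℝ 3 F x ![a, b, c] = fderiv ℝ (fderiv ℝ (fderiv ℝ F)) x a b c := by
  rw [iteratedFDeriv_succ_apply_right, iteratedFDeriv_two_apply]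
  rfl

theorem differentiableAt_fderiv_fderiv {F : E → ℝ} {x : E} (hF : ContDiffAt ℝ 3 F x) :
    DifferentiableAt ℝ (fderiv ℝ (fderiv ℝ F)) x := by
  have h1 : ContDiffAt ℝ 2 (fderiv ℝ F) x := hF.fderiv_right (by norm_num)
  have h2 : ContDiffAt ℝ 1 (fderiv ℝ (fderiv ℝ F)) x := h1.fderiv_right (by norm_num)
  exact h2.differentiableAt (by norm_num)

theorem third_fderiv_swap_left {F : E → ℝ} {x : E} (hF : ContDiffAt ℝ 3 F x) (a b c : E) :
    fderiv ℝ (fderiv ℝ (fderiv ℝ F)) x a b c = fderiv ℝ (fderiv ℝ (fderiv ℝ F)) x b a c := by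
  have h1 : ContDiffAt ℝ 2 (fderiv ℝ F) x := hF.fderiv_right (by norm_num)
  rw [(h1.isSymmSndFDerivAt (by simp)).eq]

theorem hasDerivAt_fderiv_fderiv_line {F : E → ℝ} {x h : E} {t : ℝ}
    (hF : ContDiffAt ℝ 3 F (x + t • h)) (b c : E) :
    HasDerivAt (fun s : ℝ => fderiv ℝ (fderiv ℝ F) (x + s • h) b c)
      (fderiv ℝ (fderiv ℝ (fderiv ℝ F)) (x + t • h) h b c) t := by
  have hl : HasDerivAt (fun s : ℝ => x + s • h) h t := by
    simpa using ((hasDerivAt_id t).smul_const h).const_add x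
  have := HasFDerivAt.comp_hasDerivAt (l := fderiv ℝ (fderiv ℝ F)) t
    (differentiableAt_fderiv_fderiv hF).hasFDerivAt hl
  have h2 := (this.clm_apply (hasDerivAt_const t b)).clm_apply (hasDerivAt_const t c)
  simpa using h2

theorem third_fderiv_swap_right {F : E → ℝ} {x : E} (hF : ContDiffAt ℝ 3 F x) (a b c : E) :
    fderiv ℝ (fderiv ℝ (fderiv ℝ F)) x a b c = fderiv ℝ (fderiv ℝ (fderiv ℝ F)) x a c b := by
  have hx : ContDiffAt ℝ 3 F (x + (0 : ℝ) • a) := by simpa using hF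
  have h1 := hasDerivAt_fderiv_fderiv_line hx b c
  have h2 := hasDerivAt_fderiv_fderiv_line hx c b
  rw [zero_smul, add_zero] at h1 h2
  refine h1.unique (h2.congr_of_eventuallyEq ?_)
  have hc : Filter.Tendsto (fun s : ℝ => x + s • a) (nhds 0) (nhds x) := by
    have : Continuous (fun s : ℝ => x + s • a) := by fun_prop
    simpa using this.tendsto 0
  filter_upwards [hc.eventually (hF.eventually (by norm_num))] with s hs
  exact (hs.isSymmSndFDerivAt (by simp; norm_num)).eq b c

end

/-- The differential inequality `|ψ'| ≤ 2 ψ^{3/2}` integrated on `[0, 1]`. -/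
theorem sqrt_le_of_abs_deriv_le {ψ ψ' : ℝ → ℝ}
    (hψ : ∀ t ∈ Set.Icc (0 : ℝ) 1, HasDerivAt ψ (ψ' t) t)
    (hpos : ∀ t ∈ Set.Icc (0 : ℝ) 1, 0 < ψ t)
    (hb : ∀ t ∈ Set.Icc (0 : ℝ) 1, |ψ' t| ≤ 2 * Real.sqrt (ψ t) ^ 3) :
    ∀ t ∈ Set.Icc (0 : ℝ) 1, Real.sqrt (ψ t) * (1 - Real.sqrt (ψ 0) * t) ≤ Real.sqrt (ψ 0) := by
  intro t ht
  have hd : ∀ s ∈ Set.Icc (0 : ℝ) 1, HasDerivAt (fun s => (Real.sqrt (ψ s))⁻¹ + s)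
      (-(ψ' s / (2 * Real.sqrt (ψ s))) / Real.sqrt (ψ s) ^ 2 + 1) s := fun s hs =>
    (((hψ s hs).sqrt (hpos s hs).ne').inv (Real.sqrt_pos.mpr (hpos s hs)).ne').add (hasDerivAt_id s)
  have hm : MonotoneOn (fun s => (Real.sqrt (ψ s))⁻¹ + s) (Set.Icc 0 1) := by
    refine monotoneOn_of_hasDerivWithinAt_nonneg (convex_Icc 0 1)
      (fun s hs => (hd s hs).continuousAt.continuousWithinAt)
      (fun s hs => (hd s (interior_subset hs)).hasDerivWithinAt) fun s hs => ?_
    have hs := interior_subset hs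
    have hr := Real.sqrt_pos.mpr (hpos s hs)
    have := (abs_le.mp (hb s hs)).2
    rw [neg_div, div_div, neg_add_eq_sub, sub_nonneg, div_le_one (by positivity)]
    linarith
  have := hm ⟨le_rfl, zero_le_one⟩ ht ht.1
  have hr := Real.sqrt_pos.mpr (hpos t ht)
  have hr0 := Real.sqrt_pos.mpr (hpos 0 ⟨le_rfl, zero_le_one⟩)
  simp only [add_zero] at this
  generalize Real.sqrt (ψ t) = a at *
  generalize Real.sqrt (ψ 0) = r at *
  have h3 := mul_le_mul_of_nonneg_left this (mul_pos hr hr0).le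
  have e1 : a * r * r⁻¹ = a := by field_simp
  have e2 : a * r * (a⁻¹ + t) = r + a * r * t := by field_simp
  rw [e1, e2] at h3
  linarith

/-- The differential inequality `|φ'| ≤ 2 r φ / (1 - r t)` integrated on `[0, 1]`. -/
theorem comparison_of_abs_deriv_le {φ φ' : ℝ → ℝ} {r : ℝ} (hr0 : 0 ≤ r) (hr1 : r < 1)
    (hφ : ∀ t ∈ Set.Icc (0 : ℝ) 1, HasDerivAt φ (φ' t) t)
    (hb : ∀ t ∈ Set.Icc (0 : ℝ) 1, |φ' t| * (1 - r * t) ≤ 2 * r * φ t) :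
    (1 - r) ^ 2 * φ 0 ≤ φ 1 ∧ φ 1 ≤ ((1 - r) ^ 2)⁻¹ * φ 0 := by
  have hp : ∀ t ∈ Set.Icc (0 : ℝ) 1, 0 < 1 - r * t := fun t ht => by nlinarith [ht.1, ht.2]
  have hl : ∀ t : ℝ, HasDerivAt (fun t => (1 - r * t) ^ 2) (-(2 * r * (1 - r * t))) t := fun t => by
    refine (((((hasDerivAt_id t).const_mul r).const_sub 1).pow 2)).congr_deriv ?_
    simp
    ring
  have hd₁ : ∀ t ∈ Set.Icc (0 : ℝ) 1, HasDerivAt (fun t => φ t * (1 - r * t) ^ 2)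
      (φ' t * (1 - r * t) ^ 2 + φ t * (-(2 * r * (1 - r * t)))) t := fun t ht =>
    (hφ t ht).mul (hl t)
  have hd₂ : ∀ t ∈ Set.Icc (0 : ℝ) 1, HasDerivAt (fun t => φ t / (1 - r * t) ^ 2)
      ((φ' t * (1 - r * t) ^ 2 - φ t * (-(2 * r * (1 - r * t)))) / ((1 - r * t) ^ 2) ^ 2) t :=
    fun t ht => (hφ t ht).div (hl t) (pow_pos (hp t ht) 2).ne'
  have ha : AntitoneOn (fun t => φ t * (1 - r * t) ^ 2) (Set.Icc 0 1) := by
    refine antitoneOn_of_hasDerivWithinAt_nonpos (convex_Icc 0 1)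
      (fun s hs => (hd₁ s hs).continuousAt.continuousWithinAt)
      (fun s hs => (hd₁ s (interior_subset hs)).hasDerivWithinAt) fun s hs => ?_
    have hs := interior_subset hs
    have h := hp s hs
    have h2 := mul_le_mul_of_nonneg_right (le_abs_self (φ' s)) h.le
    nlinarith [hb s hs, mul_le_mul_of_nonneg_right (h2.trans (hb s hs)) h.le]
  have hm : MonotoneOn (fun t => φ t / (1 - r * t) ^ 2) (Set.Icc 0 1) := by
    refine monotoneOn_of_hasDerivWithinAt_nonneg (convex_Icc 0 1)
      (fun s hs => (hd₂ s hs).continuousAt.continuousWithinAt)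
      (fun s hs => (hd₂ s (interior_subset hs)).hasDerivWithinAt) fun s hs => ?_
    have hs := interior_subset hs
    have h := hp s hs
    have h2 := mul_le_mul_of_nonneg_right (neg_le_abs (φ' s)) h.le
    refine div_nonneg ?_ (by positivity)
    nlinarith [hb s hs, mul_le_mul_of_nonneg_right (h2.trans (hb s hs)) h.le]
  have h01 : (0 : ℝ) ∈ Set.Icc (0 : ℝ) 1 := ⟨le_rfl, zero_le_one⟩
  have h11 : (1 : ℝ) ∈ Set.Icc (0 : ℝ) 1 := ⟨zero_le_one, le_rfl⟩
  have hA := ha h01 h11 zero_le_one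
  have hM := hm h01 h11 zero_le_one
  have h1r : 0 < (1 - r) ^ 2 := pow_pos (by linarith) 2
  simp only [mul_one, mul_zero, sub_zero, one_pow, div_one] at hA hM
  constructor
  · rwa [le_div_iff₀ h1r, mul_comm] at hM
  · rwa [inv_mul_eq_div, le_div_iff₀ h1r]

/-- **Hessian comparison inside Dikin ellipsoids.** For a self-concordant `F`
(with `M = 2`) and `x, y ∈ dom F` with `r = ‖y−x‖_x < 1`,
`(1−r)²⟨∇²F(x)u,u⟩ ≤ ⟨∇²F(y)u,u⟩ ≤ (1−r)⁻²⟨∇²F(x)u,u⟩` for all `u`. -/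
theorem sc_hessian_comparison {E : Type*} [NormedAddCommGroup E]
    [InnerProductSpace ℝ E] [FiniteDimensional ℝ E]
    (D : Set E) (hDo : IsOpen D) (hDc : Convex ℝ D)
    (F : E → ℝ)
    (hclosed : LowerSemicontinuous (fun x => if x ∈ D then (F x : EReal) else ⊤))
    (hconv : ConvexOn ℝ D F)
    (hF : ContDiffOn ℝ 3 F D)
    (hpos : ∀ x ∈ D, ∀ u : E, u ≠ 0 → 0 < hessQ F x u)
    (hsc : ∀ x ∈ D, ∀ u : E, |thirdD F x u| ≤ 2 * (hessQ F x u) ^ ((3 : ℝ) / 2)) :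
    ∀ x ∈ D, ∀ y ∈ D, locNorm F x (y - x) < 1 → ∀ u : E,
      (1 - locNorm F x (y - x)) ^ 2 * hessQ F x u ≤ hessQ F y u ∧
      hessQ F y u ≤ ((1 - locNorm F x (y - x)) ^ 2)⁻¹ * hessQ F x u := by
  intro x hx y hy hr u
  have hq : ∀ z v, hessQ F z v = fderiv ℝ (fderiv ℝ F) z v v := fun z v => by
    rw [hessQ, iteratedFDeriv_two_apply]; rfl
  have hC : ∀ z ∈ D, ContDiffAt ℝ 3 F z := fun z hz => hF.contDiffAt (hDo.mem_nhds hz)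
  have hnn : ∀ z ∈ D, ∀ v, 0 ≤ hessQ F z v := fun z hz v => by
    rcases eq_or_ne v 0 with rfl | hv
    · simp [hq]
    · exact (hpos z hz v hv).le
  have hsc' : ∀ z ∈ D, ∀ v,
      |fderiv ℝ (fderiv ℝ (fderiv ℝ F)) z v v v| ≤ 2 * Real.sqrt (hessQ F z v) ^ 3 := by
    intro z hz v
    have := hsc z hz v
    rwa [thirdD, iteratedFDeriv_three_apply, show (3 : ℝ) / 2 = 1 / 2 * (3 : ℕ) by norm_num,
      Real.rpow_mul_natCast (hnn z hz v), ← Real.sqrt_eq_rpow] at this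
  have htri : ∀ z ∈ D, ∀ h v, |fderiv ℝ (fderiv ℝ (fderiv ℝ F)) z h v v| ≤
      2 * Real.sqrt (hessQ F z h) * hessQ F z v := by
    intro z hz h v
    simp only [hq] at hsc' hpos ⊢
    exact abs_trilinear_le _ _ (third_fderiv_swap_left (hC z hz))
      (third_fderiv_swap_right (hC z hz))
      (((hC z hz).isSymmSndFDerivAt (by simp; norm_num)).eq) (hpos z hz) zero_le_two
      (hsc' z hz) h v
  obtain ⟨h, rfl⟩ : ∃ h, y = x + h := ⟨y - x, by abel⟩
  rw [add_sub_cancel_left] at hr ⊢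
  rcases eq_or_ne h 0 with rfl | hh
  · simp [locNorm, hq]
  have hseg : ∀ t ∈ Set.Icc (0 : ℝ) 1, x + t • h ∈ D := fun t ht => by
    have := hDc.add_smul_sub_mem hx hy ht
    rwa [add_sub_cancel_left] at this
  have hder : ∀ v, ∀ t ∈ Set.Icc (0 : ℝ) 1, HasDerivAt (fun s : ℝ => hessQ F (x + s • h) v)
      (fderiv ℝ (fderiv ℝ (fderiv ℝ F)) (x + t • h) h v v) t := fun v t ht => by
    simp only [hq]
    exact hasDerivAt_fderiv_fderiv_line (hC _ (hseg t ht)) v v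
  have hψ := sqrt_le_of_abs_deriv_le (hder h) (fun t ht => hpos _ (hseg t ht) h hh)
    (fun t ht => hsc' _ (hseg t ht) h)
  have hfin := comparison_of_abs_deriv_le (Real.sqrt_nonneg _) hr (hder u) fun t ht => ?_
  · simpa [locNorm] using hfin
  · have h1 := hψ t ht
    simp only [zero_smul, add_zero] at h1
    have h2 : 0 ≤ 1 - locNorm F x h * t := by
      have := Real.sqrt_nonneg (hessQ F x h)
      rw [← locNorm] at this
      nlinarith [ht.1, ht.2]
    have h3 := hnn _ (hseg t ht) u
    calc _ ≤ 2 * Real.sqrt (hessQ F (x + t • h) h) * hessQ F (x + t • h) u *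
          (1 - locNorm F x h * t) := mul_le_mul_of_nonneg_right (htri _ (hseg t ht) h u) h2
      _ = 2 * (Real.sqrt (hessQ F (x + t • h) h) * (1 - locNorm F x h * t)) *
          hessQ F (x + t • h) u := by ring
      _ ≤ _ := by gcongr; exact h1
end

section
/- Let E be a finite-dimensional real inner product space and F : E → ℝ∪{+∞} a closed convex function, three times continuously differentiable on its open convex effective domain dom F, with positive definite Hessian ∇²F(x) at every x ∈ dom F, and self-concordant with M = 2: |D³F(x)[u,u,u]| ≤ 2 (⟨∇²F(x)u,u⟩)^{3/2} for all x ∈ dom F, u ∈ E. Then for all x, y ∈ dom F with r = ‖y − x‖_x < 1, the averaged Hessian G = ∫₀¹ ∇²F(x + τ(y − x)) dτ satisfies, for every u ∈ E, (1 − r + r²/3) ⟨∇²F(x)u,u⟩ ≤ ⟨Gu,u⟩ ≤ (1 − r)^{−1} ⟨∇²F(x)u,u⟩. -/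
open scoped Classical

/-- The Szegő inequality for binary cubic forms: a binary cubic form that is at most `C` on the
unit circle has its polarization `(v, v, w) ↦ A[v, v, w]` at most `C` on unit vectors. -/
theorem binary_cubic_polarization_le {a b d e C : ℝ}
    (H : ∀ c s : ℝ, c ^ 2 + s ^ 2 = 1 →
      c ^ 3 * a + 3 * c ^ 2 * s * b + 3 * c * s ^ 2 * d + s ^ 3 * e ≤ C)
    {p q : ℝ} (hpq : p ^ 2 + q ^ 2 = 1) : p * a + q * b ≤ C := by
  obtain ⟨θ, hp, hq⟩ : ∃ θ : ℝ, p = Real.cos θ ∧ q = Real.sin θ := by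
    have hz : ‖(⟨p, q⟩ : ℂ)‖ = 1 := by
      rw [Complex.norm_def, Complex.normSq_mk, ← sq, ← sq, hpq, Real.sqrt_one]
    refine ⟨Complex.arg ⟨p, q⟩, ?_, ?_⟩
    · rw [Complex.cos_arg (by rw [← norm_ne_zero_iff, hz]; exact one_ne_zero), hz, div_one]
    · rw [Complex.sin_arg, hz, div_one]
  set c := Real.cos (θ / 3)
  set s := Real.sin (θ / 3)
  have hcs : c ^ 2 + s ^ 2 = 1 := Real.cos_sq_add_sin_sq _
  have hp' : p = 4 * c ^ 3 - 3 * c := by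
    rw [hp, ← Real.cos_three_mul]; congr 1; ring
  have hq' : q = 3 * s - 4 * s ^ 3 := by
    rw [hq, ← Real.sin_three_mul]; congr 1; ring
  obtain ⟨t, ht⟩ : ∃ t : ℝ, t ^ 2 = 3 := ⟨√3, Real.sq_sqrt (by norm_num)⟩
  have key : ∀ σ τ : ℝ, σ ^ 2 + τ ^ 2 = 1 → ∀ k : ℝ,
      k ^ 2 * ((c * σ - s * τ) ^ 3 * a + 3 * (c * σ - s * τ) ^ 2 * (s * σ + c * τ) * b
        + 3 * (c * σ - s * τ) * (s * σ + c * τ) ^ 2 * d + (s * σ + c * τ) ^ 3 * e)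
        ≤ k ^ 2 * C := fun σ τ h k ↦
    mul_le_mul_of_nonneg_left (H _ _ (by linear_combination (c ^ 2 + s ^ 2) * h + hcs))
      (sq_nonneg k)
  have h₀ := key 1 0 (by norm_num) (3 * c ^ 2 - s ^ 2)
  have h₁ := key (-1 / 2) (t / 2) (by linear_combination ht / 4) (2 * s ^ 2 + 2 * t * c * s)
  have h₂ := key (-1 / 2) (-t / 2) (by linear_combination ht / 4) (2 * s ^ 2 - 2 * t * c * s)
  have hp₂ : p = c ^ 3 - 3 * c * s ^ 2 := by rw [hp']; linear_combination (3 * c) * hcs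
  have hq₂ : q = 3 * c ^ 2 * s - s ^ 3 := by rw [hq']; linear_combination (-3 * s) * hcs
  have ht4 : t ^ 4 = 9 := by linear_combination (t ^ 2 + 3) * ht
  have hsum := add_le_add h₀ (add_le_add h₁ h₂)
  have hR : (3 * c ^ 2 - s ^ 2) ^ 2 * C + ((2 * s ^ 2 + 2 * t * c * s) ^ 2 * C
      + (2 * s ^ 2 - 2 * t * c * s) ^ 2 * C) = 9 * (c ^ 2 + s ^ 2) ^ 2 * C := by
    linear_combination (8 * c ^ 2 * s ^ 2 * C) * ht
  rw [hR, hcs] at hsum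
  have hL : 9 * (p * a + q * b) = 9 * (c ^ 2 + s ^ 2) ^ 2 * (p * a + q * b) := by
    rw [hcs]; ring
  rw [hp₂, hq₂] at hL ⊢
  ring_nf at hsum hL ⊢
  simp only [ht, ht4] at hsum
  linarith

/-- A trilinear form `T`, symmetric in its arguments, whose cubic form is bounded by `C` on the
unit ball of an inner product `B`, satisfies `T w v v ≤ C` for unit vectors `v`, `w`. -/
theorem trilinear_le_of_cubic_le_of_unit {E : Type*} [NormedAddCommGroup E] [NormedSpace ℝ E]
    (B : E →L[ℝ] E →L[ℝ] ℝ) (T : E →L[ℝ] E →L[ℝ] E →L[ℝ] ℝ)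
    (hB : ∀ v w, B v w = B w v) (hBpos : ∀ v, v ≠ 0 → 0 < B v v)
    (hT₁ : ∀ u v w, T u v w = T v u w) (hT₂ : ∀ u v w, T u v w = T u w v) {C : ℝ}
    (hC : ∀ v, B v v ≤ 1 → T v v v ≤ C) {v w : E} (hv : B v v = 1) (hw : B w w = 1) :
    T w v v ≤ C := by
  set p := B v w with hp
  have hwv : B w v = p := hB w v
  set z := w - p • v with hz
  have hBz : B z z = 1 - p ^ 2 := by
    simp only [hz, map_sub, map_smul, sub_apply,
      smul_apply, smul_eq_mul, hv, hw, hwv, ← hp]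
    ring
  have hBz0 : 0 ≤ B z z := by
    rcases eq_or_ne z 0 with h | h
    · simp [h]
    · exact (hBpos z h).le
  set q := √(1 - p ^ 2) with hq
  have hq2 : q ^ 2 = 1 - p ^ 2 := Real.sq_sqrt (hBz ▸ hBz0)
  set e := q⁻¹ • z with he
  have hze : z = q • e := by
    rcases eq_or_ne q 0 with h | h
    · rw [h, zero_smul]
      by_contra hz0
      have := hBpos z hz0
      rw [hBz, ← hq2, h] at this
      norm_num at this
    · rw [he, smul_inv_smul₀ h]
  have hve : B v e = 0 := by
    simp [he, hz, hv, ← hp]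
  have hev : B e v = 0 := by rw [hB, hve]
  have hee : B e e ≤ 1 := by
    simp only [he, map_smul, smul_apply, smul_eq_mul, hBz, ← hq2]
    rcases eq_or_ne q 0 with h | h
    · simp [h]
    · apply le_of_eq; field_simp
  have hwe : w = p • v + q • e := by rw [← hze, hz]; abel
  have hTw : T w v v = p * T v v v + q * T e v v := by
    rw [hwe]; simp
  rw [hTw]
  refine binary_cubic_polarization_le (d := T v e e) (e := T e e e) (fun c s hcs ↦ ?_)
    (show p ^ 2 + q ^ 2 = 1 by rw [hq2]; ring)
  have h1 : T v e v = T e v v := hT₁ _ _ _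
  have h2 : T v v e = T e v v := by rw [hT₂, h1]
  have h3 : T e v e = T v e e := hT₁ _ _ _
  have h4 : T e e v = T v e e := by rw [hT₂, h3]
  convert hC (c • v + s • e) ?_ using 1
  · simp only [map_add, map_smul, add_apply, smul_apply,
      smul_eq_mul, h1, h2, h3, h4]
    ring
  · simp only [map_add, map_smul, add_apply, smul_apply,
      smul_eq_mul, hv, hve, hev]
    nlinarith [sq_nonneg s]

/-- Polarization of the self-concordance inequality. -/
theorem abs_trilinear_le_of_abs_cubic_le {E : Type*} [NormedAddCommGroup E] [NormedSpace ℝ E]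
    (B : E →L[ℝ] E →L[ℝ] ℝ) (T : E →L[ℝ] E →L[ℝ] E →L[ℝ] ℝ)
    (hB : ∀ v w, B v w = B w v) (hBpos : ∀ v, v ≠ 0 → 0 < B v v)
    (hT₁ : ∀ u v w, T u v w = T v u w) (hT₂ : ∀ u v w, T u v w = T u w v) {C : ℝ} (hC0 : 0 ≤ C)
    (hC : ∀ v, |T v v v| ≤ C * (B v v) ^ ((3 : ℝ) / 2)) (w v : E) :
    |T w v v| ≤ C * √(B w w) * B v v := by
  have hBnonneg : ∀ v, 0 ≤ B v v := fun v ↦ by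
    rcases eq_or_ne v 0 with rfl | h
    · simp
    · exact (hBpos v h).le
  have hC' : ∀ v, B v v ≤ 1 → T v v v ≤ C := fun v hv ↦
    (le_abs_self _).trans <| (hC v).trans <| mul_le_of_le_one_right hC0 <|
      Real.rpow_le_one (hBnonneg v) hv (by norm_num)
  rcases eq_or_ne v 0 with rfl | hv
  · simp
  rcases eq_or_ne w 0 with rfl | hw
  · simp
  have hunit : ∀ x : E, x ≠ 0 → B ((√(B x x))⁻¹ • x) ((√(B x x))⁻¹ • x) = 1 := fun x hx ↦ by
    have h := Real.sq_sqrt (hBnonneg x)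
    have h0 : √(B x x) ≠ 0 := (Real.sqrt_pos.2 (hBpos x hx)).ne'
    simp only [map_smul, smul_apply, smul_eq_mul]
    field_simp
    exact h.symm
  have main : ∀ x : E, x ≠ 0 → T x v v ≤ C * √(B x x) * B v v := fun x hx ↦ by
    have h := trilinear_le_of_cubic_le_of_unit B T hB hBpos hT₁ hT₂ hC' (hunit v hv) (hunit x hx)
    have h1 := Real.sqrt_pos.2 (hBpos v hv)
    have h2 := Real.sqrt_pos.2 (hBpos x hx)
    simp only [map_smul, smul_apply, smul_eq_mul] at h
    rw [← Real.sq_sqrt (hBnonneg v), mul_assoc]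
    have h3 : T x v v = √(B x x) * √(B v v) ^ 2 *
        ((√(B v v))⁻¹ * ((√(B v v))⁻¹ * ((√(B x x))⁻¹ * T x v v))) := by
      field_simp
    rw [Real.sq_sqrt (hBnonneg v)] at h3 ⊢
    rw [h3, mul_comm C]
    exact mul_le_mul_of_nonneg_left h (mul_nonneg h2.le (hBnonneg v))
  refine abs_le'.2 ⟨main w hw, ?_⟩
  simpa using main (-w) (neg_ne_zero.2 hw)

theorem hessQ_eq_fderiv {E : Type*} [NormedAddCommGroup E] [NormedSpace ℝ E]
    (F : E → ℝ) (x u : E) : hessQ F x u = fderiv ℝ (fderiv ℝ F) x u u := by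
  simp [hessQ, iteratedFDeriv_two_apply]

theorem thirdD_eq_fderiv {E : Type*} [NormedAddCommGroup E] [NormedSpace ℝ E]
    (F : E → ℝ) (x u : E) :
    thirdD F x u = fderiv ℝ (fderiv ℝ (fderiv ℝ F)) x u u u := by
  rw [thirdD, iteratedFDeriv_succ_apply_right, iteratedFDeriv_two_apply]
  rfl

/-- Along a line, the Hessian form has the third derivative as its derivative. -/
theorem hasDerivAt_hessQ_line {E : Type*} [NormedAddCommGroup E] [NormedSpace ℝ E]
    {F : E → ℝ} {x h : E} {t : ℝ} (hF : ContDiffAt ℝ 3 F (x + t • h)) (u : E) :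
    HasDerivAt (fun τ : ℝ ↦ hessQ F (x + τ • h) u)
      (fderiv ℝ (fderiv ℝ (fderiv ℝ F)) (x + t • h) h u u) t := by
  have hd : DifferentiableAt ℝ (fderiv ℝ (fderiv ℝ F)) (x + t • h) :=
    ((hF.fderiv_right (m := 2) (by norm_num)).fderiv_right (m := 1)
      (by norm_num)).differentiableAt (by norm_num)
  have hl : HasDerivAt (fun τ : ℝ ↦ x + τ • h) h t := by
    simpa using ((hasDerivAt_id t).smul_const h).const_add x
  have h2 : HasDerivAt (fun τ : ℝ ↦ fderiv ℝ (fderiv ℝ F) (x + τ • h))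
      (fderiv ℝ (fderiv ℝ (fderiv ℝ F)) (x + t • h) h) t :=
    HasFDerivAt.comp_hasDerivAt (E := E →L[ℝ] E →L[ℝ] ℝ) t hd.hasFDerivAt hl
  simp only [hessQ_eq_fderiv]
  simpa using (h2.clm_apply (hasDerivAt_const t u)).clm_apply (hasDerivAt_const t u)

/-- The mixed third derivative of a self-concordant function is controlled by local norms. -/
theorem abs_third_fderiv_le {E : Type*} [NormedAddCommGroup E] [NormedSpace ℝ E]
    {D : Set E} (hDo : IsOpen D) {F : E → ℝ} (hF : ContDiffOn ℝ 3 F D)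
    (hpos : ∀ x ∈ D, ∀ u : E, u ≠ 0 → 0 < hessQ F x u)
    (hsc : ∀ x ∈ D, ∀ u : E, |thirdD F x u| ≤ 2 * (hessQ F x u) ^ ((3 : ℝ) / 2))
    {x : E} (hx : x ∈ D) (h u : E) :
    |fderiv ℝ (fderiv ℝ (fderiv ℝ F)) x h u u| ≤ 2 * locNorm F x h * hessQ F x u := by
  have hFat : ∀ z ∈ D, ContDiffAt ℝ 3 F z := fun z hz ↦ hF.contDiffAt (hDo.mem_nhds hz)
  have hsymm : ∀ z ∈ D, ∀ v w,
      fderiv ℝ (fderiv ℝ F) z v w = fderiv ℝ (fderiv ℝ F) z w v := fun z hz v w ↦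
    ((hFat z hz).isSymmSndFDerivAt (by simp; norm_num)).eq v w
  have hF2 : ContDiffAt ℝ 2 (fderiv ℝ F) x := (hFat x hx).fderiv_right (by norm_num)
  have hd : DifferentiableAt ℝ (fderiv ℝ (fderiv ℝ F)) x :=
    (hF2.fderiv_right (m := 1) (by norm_num)).differentiableAt (by norm_num)
  have happly : ∀ a b c, fderiv ℝ (fderiv ℝ (fderiv ℝ F)) x a b c =
      fderiv ℝ (fun z ↦ fderiv ℝ (fderiv ℝ F) z b c) x a := fun a b c ↦ by
    have h1 := (hd.hasFDerivAt.clm_apply (hasFDerivAt_const b x)).clm_apply (hasFDerivAt_const c x)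
    rw [h1.fderiv]
    simp
  rw [locNorm, hessQ_eq_fderiv, hessQ_eq_fderiv]
  refine abs_trilinear_le_of_abs_cubic_le _ _ (hsymm x hx) (fun v hv ↦ ?_) (fun a b c ↦ ?_)
    (fun a b c ↦ ?_) (by norm_num) (fun v ↦ ?_) h u
  · rw [← hessQ_eq_fderiv]; exact hpos x hx v hv
  · exact congrArg (· c) ((hF2.isSymmSndFDerivAt (by simp)).eq a b)
  · rw [happly, happly]
    congr 1
    apply Filter.EventuallyEq.fderiv_eq
    filter_upwards [hDo.mem_nhds hx] with z hz using hsymm z hz b c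
  · rw [← hessQ_eq_fderiv, ← thirdD_eq_fderiv]; exact hsc x hx v

/-- If `φ > 0` and `|φ'| ≤ 2 φ^{3/2}` on `[0, 1]`, then `√φ(t) ≤ r / (1 - r t)` with `r = √φ(0)`. -/
theorem sqrt_le_div_of_abs_deriv_le {φ φ' : ℝ → ℝ}
    (hpos : ∀ t ∈ Set.Icc (0 : ℝ) 1, 0 < φ t)
    (hd : ∀ t ∈ Set.Icc (0 : ℝ) 1, HasDerivAt φ (φ' t) t)
    (hb : ∀ t ∈ Set.Icc (0 : ℝ) 1, |φ' t| ≤ 2 * √(φ t) * φ t)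
    (hr : √(φ 0) < 1) {t : ℝ} (ht : t ∈ Set.Icc (0 : ℝ) 1) :
    √(φ t) ≤ √(φ 0) / (1 - √(φ 0) * t) := by
  have hg : ∀ s ∈ Set.Icc (0 : ℝ) 1, HasDerivAt (fun s ↦ (√(φ s))⁻¹ + s)
      (-(φ' s / (2 * √(φ s))) / √(φ s) ^ 2 + 1) s := fun s hs ↦
    (((hd s hs).sqrt (hpos s hs).ne').inv (Real.sqrt_pos.2 (hpos s hs)).ne').add (hasDerivAt_id s)
  have hmono : MonotoneOn (fun s ↦ (√(φ s))⁻¹ + s) (Set.Icc 0 1) := by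
    refine monotoneOn_of_hasDerivWithinAt_nonneg (convex_Icc 0 1)
      (fun s hs ↦ (hg s hs).continuousAt.continuousWithinAt)
      (fun s hs ↦ (hg s (interior_subset hs)).hasDerivWithinAt) (fun s hs ↦ ?_)
    have hs' := interior_subset hs
    have h0 := Real.sqrt_pos.2 (hpos s hs')
    have h1 : φ' s / (2 * √(φ s)) / √(φ s) ^ 2 ≤ 1 := by
      rw [div_div, div_le_one (by positivity)]
      refine (le_abs_self _).trans ((hb s hs').trans_eq ?_)
      rw [Real.sq_sqrt (hpos s hs').le]
    rw [neg_div]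
    linarith
  have h0 := Real.sqrt_pos.2 (hpos 0 (by simp))
  have h1 := Real.sqrt_pos.2 (hpos t ht)
  have h2 : (√(φ 0))⁻¹ + 0 ≤ (√(φ t))⁻¹ + t := hmono (by simp) ht ht.1
  have h3 : 0 < 1 - √(φ 0) * t := by nlinarith [ht.1, ht.2]
  rw [le_div_iff₀ h3]
  field_simp at h2
  nlinarith

/-- If `|ψ'| ≤ 2 r / (1 - r t) ψ` on `[0, 1]`, then
`(1 - r t)² ψ(0) ≤ ψ(t) ≤ ψ(0) / (1 - r t)²`. -/
theorem sq_mul_le_and_le_div_sq_of_abs_deriv_le {ψ ψ' : ℝ → ℝ} {r : ℝ} (hr0 : 0 ≤ r) (hr : r < 1)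
    (hd : ∀ t ∈ Set.Icc (0 : ℝ) 1, HasDerivAt ψ (ψ' t) t)
    (hb : ∀ t ∈ Set.Icc (0 : ℝ) 1, |ψ' t| ≤ 2 * (r / (1 - r * t)) * ψ t)
    {t : ℝ} (ht : t ∈ Set.Icc (0 : ℝ) 1) :
    (1 - r * t) ^ 2 * ψ 0 ≤ ψ t ∧ ψ t ≤ ψ 0 / (1 - r * t) ^ 2 := by
  have hpos : ∀ s ∈ Set.Icc (0 : ℝ) 1, 0 < 1 - r * s := fun s hs ↦ by nlinarith [hs.1, hs.2]
  have hl : ∀ s, HasDerivAt (fun s ↦ (1 - r * s) ^ 2) (2 * (1 - r * s) * -r) s := fun s ↦ by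
    refine ((((hasDerivAt_id s).const_mul r).const_sub 1).pow 2).congr_deriv ?_
    simp
  have hq : ∀ s ∈ Set.Icc (0 : ℝ) 1, |ψ' s| * (1 - r * s) ≤ 2 * r * ψ s := fun s hs ↦ by
    have h := mul_le_mul_of_nonneg_right (hb s hs) (hpos s hs).le
    have h' := (hpos s hs).ne'
    refine h.trans_eq ?_
    field_simp
  constructor
  · have hg : ∀ s ∈ Set.Icc (0 : ℝ) 1, HasDerivAt (fun s ↦ ψ s / (1 - r * s) ^ 2)
        ((ψ' s * (1 - r * s) ^ 2 - ψ s * (2 * (1 - r * s) * -r)) / ((1 - r * s) ^ 2) ^ 2) s :=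
      fun s hs ↦ (hd s hs).div (hl s) (pow_ne_zero 2 (hpos s hs).ne')
    have hmono : MonotoneOn (fun s ↦ ψ s / (1 - r * s) ^ 2) (Set.Icc 0 1) := by
      refine monotoneOn_of_hasDerivWithinAt_nonneg (convex_Icc 0 1)
        (fun s hs ↦ (hg s hs).continuousAt.continuousWithinAt)
        (fun s hs ↦ (hg s (interior_subset hs)).hasDerivWithinAt) (fun s hs ↦ ?_)
      have hs' := interior_subset hs
      have h := hpos s hs'
      refine div_nonneg ?_ (by positivity)
      have h1 : 0 ≤ ψ' s * (1 - r * s) + 2 * r * ψ s := by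
        nlinarith [hq s hs', neg_abs_le (ψ' s)]
      nlinarith [mul_nonneg h.le h1]
    have h2 : ψ 0 / (1 - r * 0) ^ 2 ≤ ψ t / (1 - r * t) ^ 2 := hmono (by simp) ht ht.1
    rw [mul_zero, sub_zero, one_pow, div_one, le_div_iff₀ (pow_pos (hpos t ht) 2)] at h2
    linarith
  · have hg : ∀ s ∈ Set.Icc (0 : ℝ) 1, HasDerivAt (fun s ↦ ψ s * (1 - r * s) ^ 2)
        (ψ' s * (1 - r * s) ^ 2 + ψ s * (2 * (1 - r * s) * -r)) s :=
      fun s hs ↦ (hd s hs).mul (hl s)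
    have hanti : AntitoneOn (fun s ↦ ψ s * (1 - r * s) ^ 2) (Set.Icc 0 1) := by
      refine antitoneOn_of_hasDerivWithinAt_nonpos (convex_Icc 0 1)
        (fun s hs ↦ (hg s hs).continuousAt.continuousWithinAt)
        (fun s hs ↦ (hg s (interior_subset hs)).hasDerivWithinAt) (fun s hs ↦ ?_)
      have hs' := interior_subset hs
      have h := hpos s hs'
      have h1 : 0 ≤ 2 * r * ψ s - ψ' s * (1 - r * s) := by
        nlinarith [hq s hs', le_abs_self (ψ' s)]
      nlinarith [mul_nonneg h.le h1]
    have h2 : ψ t * (1 - r * t) ^ 2 ≤ ψ 0 * (1 - r * 0) ^ 2 := hanti (by simp) ht ht.1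
    rw [le_div_iff₀ (pow_pos (hpos t ht) 2)]
    simpa using h2

theorem integral_one_sub_mul_sq (r : ℝ) :
    ∫ t in (0 : ℝ)..1, (1 - r * t) ^ 2 = 1 - r + r ^ 2 / 3 := by
  have hd : ∀ t ∈ Set.uIcc (0 : ℝ) 1,
      HasDerivAt (fun t ↦ t - r * t ^ 2 + r ^ 2 / 3 * t ^ 3) ((1 - r * t) ^ 2) t := fun t _ ↦ by
    have h := ((hasDerivAt_id t).sub ((hasDerivAt_pow 2 t).const_mul r)).add
      ((hasDerivAt_pow 3 t).const_mul (r ^ 2 / 3))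
    refine h.congr_deriv ?_
    push_cast
    ring
  rw [intervalIntegral.integral_eq_sub_of_hasDerivAt hd
    (Continuous.intervalIntegrable (by fun_prop) _ _)]
  ring

theorem continuousOn_inv_one_sub_mul_sq {r : ℝ} (hr0 : 0 ≤ r) (hr : r < 1) :
    ContinuousOn (fun t : ℝ ↦ ((1 - r * t) ^ 2)⁻¹) (Set.uIcc 0 1) := by
  refine ContinuousOn.inv₀ (by fun_prop) fun t ht ↦ ?_
  rw [Set.uIcc_of_le zero_le_one] at ht
  exact pow_ne_zero 2 (by nlinarith [ht.1, ht.2])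

theorem integral_inv_one_sub_mul_sq {r : ℝ} (hr0 : 0 ≤ r) (hr : r < 1) :
    ∫ t in (0 : ℝ)..1, ((1 - r * t) ^ 2)⁻¹ = (1 - r)⁻¹ := by
  have hd : ∀ t ∈ Set.uIcc (0 : ℝ) 1,
      HasDerivAt (fun t ↦ t / (1 - r * t)) (((1 - r * t) ^ 2)⁻¹) t := fun t ht ↦ by
    rw [Set.uIcc_of_le zero_le_one] at ht
    have h0 : 1 - r * t ≠ 0 := by nlinarith [ht.1, ht.2]
    refine ((hasDerivAt_id t).div (((hasDerivAt_id t).const_mul r).const_sub 1) h0).congr_deriv ?_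
    rw [inv_eq_one_div]
    congr 1
    simp
    ring
  rw [intervalIntegral.integral_eq_sub_of_hasDerivAt hd
    (continuousOn_inv_one_sub_mul_sq hr0 hr).intervalIntegrable]
  simp

/-- **Bounds on the averaged Hessian.** For a self-concordant `F` (with `M = 2`) and
`x, y ∈ dom F` with `r = ‖y−x‖_x < 1`, the averaged Hessian
`G = ∫₀¹ ∇²F(x+τ(y−x)) dτ` satisfies
`(1−r+r²/3)⟨∇²F(x)u,u⟩ ≤ ⟨Gu,u⟩ ≤ (1−r)⁻¹⟨∇²F(x)u,u⟩` for all `u`. -/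
theorem sc_averaged_hessian_bounds {E : Type*} [NormedAddCommGroup E]
    [InnerProductSpace ℝ E] [FiniteDimensional ℝ E]
    (D : Set E) (hDo : IsOpen D) (hDc : Convex ℝ D)
    (F : E → ℝ)
    (hclosed : LowerSemicontinuous (fun x => if x ∈ D then (F x : EReal) else ⊤))
    (hconv : ConvexOn ℝ D F)
    (hF : ContDiffOn ℝ 3 F D)
    (hpos : ∀ x ∈ D, ∀ u : E, u ≠ 0 → 0 < hessQ F x u)
    (hsc : ∀ x ∈ D, ∀ u : E, |thirdD F x u| ≤ 2 * (hessQ F x u) ^ ((3 : ℝ) / 2)) :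
    ∀ x ∈ D, ∀ y ∈ D, locNorm F x (y - x) < 1 → ∀ u : E,
      (1 - locNorm F x (y - x) + (locNorm F x (y - x)) ^ 2 / 3) * hessQ F x u ≤
          ∫ τ in (0 : ℝ)..1, hessQ F (x + τ • (y - x)) u ∧
      ∫ τ in (0 : ℝ)..1, hessQ F (x + τ • (y - x)) u ≤
          (1 - locNorm F x (y - x))⁻¹ * hessQ F x u := by
  intro x hx y hy hr u
  set h := y - x with hh
  set r := locNorm F x h with hrdef
  have hr0 : 0 ≤ r := Real.sqrt_nonneg _
  have hmem : ∀ t ∈ Set.Icc (0 : ℝ) 1, x + t • h ∈ D := fun t ht ↦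
    hDc.add_smul_sub_mem hx hy ht
  have hdiff : ∀ v : E, ∀ t ∈ Set.Icc (0 : ℝ) 1, HasDerivAt (fun τ : ℝ ↦ hessQ F (x + τ • h) v)
      (fderiv ℝ (fderiv ℝ (fderiv ℝ F)) (x + t • h) h v v) t := fun v t ht ↦
    hasDerivAt_hessQ_line (hF.contDiffAt (hDo.mem_nhds (hmem t ht))) v
  have hbd : ∀ v : E, ∀ t ∈ Set.Icc (0 : ℝ) 1,
      |fderiv ℝ (fderiv ℝ (fderiv ℝ F)) (x + t • h) h v v| ≤
        2 * locNorm F (x + t • h) h * hessQ F (x + t • h) v := fun v t ht ↦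
    abs_third_fderiv_le hDo hF hpos hsc (hmem t ht) h v
  have hnonneg : ∀ z ∈ D, 0 ≤ hessQ F z u := fun z hz ↦ by
    rcases eq_or_ne u 0 with rfl | hu
    · simp [hessQ_eq_fderiv]
    · exact (hpos z hz u hu).le
  have hloc : ∀ t ∈ Set.Icc (0 : ℝ) 1, locNorm F (x + t • h) h ≤ r / (1 - r * t) := by
    intro t ht
    rcases eq_or_ne h 0 with h0 | h0
    · simp [hrdef, h0, locNorm, hessQ_eq_fderiv]
    · simpa [hrdef, locNorm] using sqrt_le_div_of_abs_deriv_le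
        (φ := fun τ : ℝ ↦ hessQ F (x + τ • h) h)
        (fun s hs ↦ hpos _ (hmem s hs) h h0) (hdiff h) (hbd h) (by simpa [hrdef, locNorm] using hr) ht
  have hψ : ∀ t ∈ Set.Icc (0 : ℝ) 1, (1 - r * t) ^ 2 * hessQ F x u ≤ hessQ F (x + t • h) u ∧
      hessQ F (x + t • h) u ≤ hessQ F x u / (1 - r * t) ^ 2 := fun t ht ↦ by
    simpa using sq_mul_le_and_le_div_sq_of_abs_deriv_le
      (ψ := fun τ : ℝ ↦ hessQ F (x + τ • h) u) hr0 hr (hdiff u)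
      (fun s hs ↦ (hbd u s hs).trans (mul_le_mul_of_nonneg_right
        (mul_le_mul_of_nonneg_left (hloc s hs) zero_le_two) (hnonneg _ (hmem s hs)))) ht
  have hint : IntervalIntegrable (fun τ : ℝ ↦ hessQ F (x + τ • h) u) MeasureTheory.volume 0 1 := by
    refine ContinuousOn.intervalIntegrable fun t ht ↦ ?_
    rw [Set.uIcc_of_le zero_le_one] at ht
    exact (hdiff u t ht).continuousAt.continuousWithinAt
  constructor
  · rw [← integral_one_sub_mul_sq, ← intervalIntegral.integral_mul_const]
    exact intervalIntegral.integral_mono_on zero_le_one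
      (Continuous.intervalIntegrable (by fun_prop) _ _) hint fun t ht ↦ (hψ t ht).1
  · rw [← integral_inv_one_sub_mul_sq hr0 hr, ← intervalIntegral.integral_mul_const]
    refine intervalIntegral.integral_mono_on zero_le_one hint
      ((continuousOn_inv_one_sub_mul_sq hr0 hr).intervalIntegrable.mul_const _) fun t ht ↦ ?_
    rw [mul_comm, ← div_eq_mul_inv]
    exact (hψ t ht).2
end

section
/- Let E be a finite-dimensional real inner product space and F : E → ℝ∪{+∞} a closed convex function, three times continuously differentiable on its open convex effective domain dom F, with positive definite Hessian ∇²F(x) at every x ∈ dom F, and self-concordant with M = 2: |D³F(x)[u,u,u]| ≤ 2 (⟨∇²F(x)u,u⟩)^{3/2} for all x ∈ dom F, u ∈ E. Then for all x, y ∈ dom F: ⟨∇F(y) − ∇F(x), y − x⟩ ≥ ‖y − x‖_x² / (1 + ‖y − x‖_x), and if ‖y − x‖_x < 1 then ⟨∇F(y) − ∇F(x), y − x⟩ ≤ ‖y − x‖_x² / (1 − ‖y − x‖_x). -/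
open scoped Classical RealInnerProductSpace

/-- The derivative of `t ↦ Dⁿf(x + tu)[u, …, u]` is `Dⁿ⁺¹f(x + tu)[u, …, u]`. -/
lemma hasDerivAt_iteratedFDeriv_apply_line {E : Type*} [NormedAddCommGroup E] [NormedSpace ℝ E]
    {f : E → ℝ} {x u : E} {t : ℝ} {n : ℕ} (hf : ContDiffAt ℝ (n + 1) f (x + t • u)) :
    HasDerivAt (fun s : ℝ => iteratedFDeriv ℝ n f (x + s • u) fun _ => u)
      (iteratedFDeriv ℝ (n + 1) f (x + t • u) fun _ => u) t := by
  have hd : DifferentiableAt ℝ (iteratedFDeriv ℝ n f) (x + t • u) :=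
    hf.differentiableAt_iteratedFDeriv (by exact_mod_cast Nat.lt_succ_self n)
  have hline : HasDerivAt (fun s : ℝ => x + s • u) u t := by
    simpa using ((hasDerivAt_id t).smul_const u).const_add x
  exact (hd.hasFDerivAt.continuousMultilinear_apply_const fun _ => u).comp_hasDerivAt t hline

/-- If `g > 0` satisfies `|g'| ≤ 2 g^{3/2}` on `[0, 1]`, then `g^{-1/2}` is `1`-Lipschitz there. -/
lemma abs_inv_sqrt_sub_le {g k : ℝ → ℝ} (hg : ∀ t ∈ Set.Icc (0 : ℝ) 1, HasDerivAt g (k t) t)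
    (hpos : ∀ t ∈ Set.Icc (0 : ℝ) 1, 0 < g t)
    (hk : ∀ t ∈ Set.Icc (0 : ℝ) 1, |k t| ≤ 2 * g t ^ ((3 : ℝ) / 2))
    {t : ℝ} (ht : t ∈ Set.Icc (0 : ℝ) 1) : |(√(g t))⁻¹ - (√(g 0))⁻¹| ≤ t := by
  have hderiv : ∀ s ∈ Set.Icc (0 : ℝ) 1, HasDerivAt (fun s => (√(g s))⁻¹)
      (-(k s / (2 * √(g s))) / √(g s) ^ 2) s := fun s hs =>
    ((hg s hs).sqrt (hpos s hs).ne').inv (Real.sqrt_pos.2 (hpos s hs)).ne'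
  have hmain := norm_image_sub_le_of_norm_deriv_le_segment' (C := 1)
    (fun s hs => (hderiv s hs).hasDerivWithinAt) (fun s hs => ?_) t ht
  · simpa using hmain
  · have hs' := Set.Ico_subset_Icc_self hs
    have hsq := Real.sqrt_pos.2 (hpos s hs')
    have hb := hk s hs'
    have hrpow : g s ^ ((3 : ℝ) / 2) = √(g s) ^ 3 := by
      rw [Real.sqrt_eq_rpow, ← Real.rpow_natCast, ← Real.rpow_mul (hpos s hs').le]
      norm_num
    rw [hrpow] at hb
    rw [Real.norm_eq_abs, abs_div, abs_neg, abs_div, abs_of_pos (by positivity : 0 < 2 * √(g s)),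
      abs_of_pos (by positivity : 0 < √(g s) ^ 2), div_div, div_le_one (by positivity)]
    linarith

/-- The derivative of `t ↦ r² t / (1 + c t)` is `(r / (1 + c t))²`. -/
lemma hasDerivAt_sq_mul_div_one_add_mul {r c t : ℝ} (h : 1 + c * t ≠ 0) :
    HasDerivAt (fun s : ℝ => r ^ 2 * s / (1 + c * s)) ((r / (1 + c * t)) ^ 2) t := by
  have h1 := ((hasDerivAt_id t).const_mul (r ^ 2)).div
    (((hasDerivAt_id t).const_mul c).const_add 1) h
  refine h1.congr_deriv ?_
  simp only [id]
  field_simp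
  ring

/-- One-dimensional form of the gradient bounds: `h` is the derivative of a self-concordant
function on `[0, 1]`, with second derivative `g` and third derivative `k`. -/
lemma sub_bounds_of_abs_deriv_le_rpow {h g k : ℝ → ℝ}
    (hh : ∀ t ∈ Set.Icc (0 : ℝ) 1, HasDerivAt h (g t) t)
    (hg : ∀ t ∈ Set.Icc (0 : ℝ) 1, HasDerivAt g (k t) t)
    (hpos : ∀ t ∈ Set.Icc (0 : ℝ) 1, 0 < g t)
    (hk : ∀ t ∈ Set.Icc (0 : ℝ) 1, |k t| ≤ 2 * g t ^ ((3 : ℝ) / 2)) :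
    √(g 0) ^ 2 / (1 + √(g 0)) ≤ h 1 - h 0 ∧
      (√(g 0) < 1 → h 1 - h 0 ≤ √(g 0) ^ 2 / (1 - √(g 0))) := by
  have hr : 0 < √(g 0) := Real.sqrt_pos.2 (hpos 0 (by simp))
  set r := √(g 0)
  have hgsq : ∀ t ∈ Set.Icc (0 : ℝ) 1, g t = √(g t) ^ 2 := fun t ht =>
    (Real.sq_sqrt (hpos t ht).le).symm
  have hsq : ∀ t ∈ Set.Icc (0 : ℝ) 1, 0 < √(g t) := fun t ht => Real.sqrt_pos.2 (hpos t ht)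
  have hlip : ∀ t ∈ Set.Icc (0 : ℝ) 1, |(√(g t))⁻¹ - r⁻¹| ≤ t := fun t ht =>
    abs_inv_sqrt_sub_le hg hpos hk ht
  have hh' : ∀ t ∈ Set.Icc (0 : ℝ) 1, HasDerivAt (fun s => h s - h 0) (g t) t := fun t ht =>
    (hh t ht).sub_const _
  constructor
  · have hB : ∀ t ∈ Set.Icc (0 : ℝ) 1,
        HasDerivAt (fun s : ℝ => r ^ 2 * s / (1 + r * s)) ((r / (1 + r * t)) ^ 2) t := by
      intro t ht
      have := ht.1
      exact hasDerivAt_sq_mul_div_one_add_mul (by positivity)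
    have hfin := image_le_of_deriv_right_le_deriv_boundary
      (fun t ht => (hB t ht).continuousAt.continuousWithinAt)
      (fun t ht => (hB t (Set.Ico_subset_Icc_self ht)).hasDerivWithinAt)
      (by simp)
      (fun t ht => (hh' t ht).continuousAt.continuousWithinAt)
      (fun t ht => (hh' t (Set.Ico_subset_Icc_self ht)).hasDerivWithinAt)
      (fun t ht => ?_) (Set.right_mem_Icc.2 zero_le_one)
    · simpa using hfin
    · have ht' := Set.Ico_subset_Icc_self ht
      have ht0 := ht.1
      have hs := hsq t ht'
      rw [hgsq t ht']
      have hle := (abs_le.1 (hlip t ht')).2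
      gcongr
      rw [div_le_iff₀ (by positivity)]
      have hmul := mul_le_mul_of_nonneg_left hle (by positivity : 0 ≤ √(g t) * r)
      field_simp at hmul
      linarith
  · intro hr1
    have hden : ∀ t ∈ Set.Icc (0 : ℝ) 1, 0 < 1 + -r * t := fun t ht => by
      nlinarith [ht.1, ht.2]
    have hB : ∀ t ∈ Set.Icc (0 : ℝ) 1,
        HasDerivAt (fun s : ℝ => r ^ 2 * s / (1 + -r * s)) ((r / (1 + -r * t)) ^ 2) t :=
      fun t ht => hasDerivAt_sq_mul_div_one_add_mul (hden t ht).ne'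
    have hfin := image_le_of_deriv_right_le_deriv_boundary
      (fun t ht => (hh' t ht).continuousAt.continuousWithinAt)
      (fun t ht => (hh' t (Set.Ico_subset_Icc_self ht)).hasDerivWithinAt)
      (by simp)
      (fun t ht => (hB t ht).continuousAt.continuousWithinAt)
      (fun t ht => (hB t (Set.Ico_subset_Icc_self ht)).hasDerivWithinAt)
      (fun t ht => ?_) (Set.right_mem_Icc.2 zero_le_one)
    · simpa [sub_eq_add_neg] using hfin
    · have ht' := Set.Ico_subset_Icc_self ht
      have hs := hsq t ht'
      rw [hgsq t ht']
      have hle := (abs_le.1 (hlip t ht')).1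
      gcongr
      rw [le_div_iff₀ (hden t ht')]
      have hmul := mul_le_mul_of_nonneg_left hle (by positivity : 0 ≤ √(g t) * r)
      field_simp at hmul
      linarith

/-- **Strict monotonicity bounds for the gradient of a self-concordant function.**
For a self-concordant `F` (with `M = 2`) and `x, y ∈ dom F`,
`⟨∇F(y)−∇F(x), y−x⟩ ≥ ‖y−x‖_x²/(1+‖y−x‖_x)`, and if `‖y−x‖_x < 1` then
`⟨∇F(y)−∇F(x), y−x⟩ ≤ ‖y−x‖_x²/(1−‖y−x‖_x)`. -/
theorem sc_gradient_monotonicity_bounds {E : Type*} [NormedAddCommGroup E]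
    [InnerProductSpace ℝ E] [FiniteDimensional ℝ E]
    (D : Set E) (hDo : IsOpen D) (hDc : Convex ℝ D)
    (F : E → ℝ)
    (hclosed : LowerSemicontinuous (fun x => if x ∈ D then (F x : EReal) else ⊤))
    (hconv : ConvexOn ℝ D F)
    (hF : ContDiffOn ℝ 3 F D)
    (hpos : ∀ x ∈ D, ∀ u : E, u ≠ 0 → 0 < hessQ F x u)
    (hsc : ∀ x ∈ D, ∀ u : E, |thirdD F x u| ≤ 2 * (hessQ F x u) ^ ((3 : ℝ) / 2)) :
    ∀ x ∈ D, ∀ y ∈ D,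
      ⟪gradient F y - gradient F x, y - x⟫ ≥
          (locNorm F x (y - x)) ^ 2 / (1 + locNorm F x (y - x)) ∧
      (locNorm F x (y - x) < 1 →
        ⟪gradient F y - gradient F x, y - x⟫ ≤
          (locNorm F x (y - x)) ^ 2 / (1 - locNorm F x (y - x))) := by
  intro x hx y hy
  obtain ⟨u, rfl⟩ : ∃ u, y = x + u := ⟨y - x, by abel⟩
  rw [add_sub_cancel_left]
  rcases eq_or_ne u 0 with rfl | hu
  · have hzero : hessQ F x 0 = 0 := ContinuousMultilinearMap.map_coord_zero _ 0 rfl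
    simp [locNorm, hzero]
  have hD : ∀ t ∈ Set.Icc (0 : ℝ) 1, x + t • u ∈ D := fun t ht =>
    hDc.add_smul_mem hx hy ht
  have hFat : ∀ t ∈ Set.Icc (0 : ℝ) 1, ContDiffAt ℝ 3 F (x + t • u) := fun t ht =>
    hF.contDiffAt (hDo.mem_nhds (hD t ht))
  have hcons2 : (![u, u] : Fin 2 → E) = fun _ => u := by
    ext i; fin_cases i <;> rfl
  have hcons3 : Matrix.vecCons u (fun _ : Fin 2 => u) = fun _ => u := by
    ext i; fin_cases i <;> rfl
  have hmain := sub_bounds_of_abs_deriv_le_rpow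
    (h := fun t => iteratedFDeriv ℝ 1 F (x + t • u) fun _ => u)
    (g := fun t => hessQ F (x + t • u) u) (k := fun t => thirdD F (x + t • u) u)
    (fun t ht => by
      simp only [hessQ, hcons2]
      exact hasDerivAt_iteratedFDeriv_apply_line ((hFat t ht).of_le (by norm_num)))
    (fun t ht => by
      simp only [hessQ, thirdD, hcons2, hcons3]
      exact hasDerivAt_iteratedFDeriv_apply_line ((hFat t ht).of_le (by norm_num)))
    (fun t ht => hpos _ (hD t ht) u hu) (fun t ht => hsc _ (hD t ht) u)
  have hinner : ⟪gradient F (x + u) - gradient F x, u⟫ =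
      fderiv ℝ F (x + u) u - fderiv ℝ F x u := by
    simp [gradient, inner_sub_left]
  rw [hinner]
  simpa [locNorm] using hmain
end

section
/- Let E be a finite-dimensional real inner product space and F : E → ℝ∪{+∞} a closed (lower semicontinuous) convex function with open effective domain dom F, real-valued and continuous on dom F. Then for any boundary point x̄ ∈ ∂(dom F) and any sequence (x_s) ⊂ dom F with x_s → x̄, one has lim_{s→∞} F(x_s) = +∞; in particular any closed convex function with open domain, and hence any self-concordant function, is a barrier function on the closure of its domain. -/
open scoped Classical
open Filter

/-- **Closed convex functions with open domain are barrier functions.** If `F` is a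
closed (lower semicontinuous as an `ℝ∪{+∞}`-valued function) convex function whose
effective domain `D` is open, `F` being real-valued and continuous on `D`, then for any
boundary point `x̄` of `D` and any sequence `(x_s) ⊆ D` converging to `x̄`, the values
`F(x_s)` tend to `+∞`. -/
theorem closed_convex_barrier {E : Type*} [NormedAddCommGroup E]
    [InnerProductSpace ℝ E] [FiniteDimensional ℝ E]
    (D : Set E) (hDo : IsOpen D) (hDc : Convex ℝ D)
    (F : E → ℝ)
    (hclosed : LowerSemicontinuous (fun x => if x ∈ D then (F x : EReal) else ⊤))
    (hconv : ConvexOn ℝ D F) (hcont : ContinuousOn F D)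
    (xbar : E) (hxbar : xbar ∈ frontier D)
    (x : ℕ → E) (hx : ∀ s, x s ∈ D)
    (hlim : Tendsto x atTop (nhds xbar)) :
    Tendsto (fun s => F (x s)) atTop atTop := by
  have hnot : xbar ∉ D := by
    rw [hDo.frontier_eq] at hxbar
    exact hxbar.2
  refine tendsto_atTop.2 fun b => ?_
  have hev := hlim.eventually (hclosed xbar (b : EReal) (by simp [hnot]))
  filter_upwards [hev] with s hs
  simp only [hx s, if_true] at hs
  exact (EReal.coe_lt_coe_iff.1 hs).le
end
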